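/- arXiv:2502.12762 — 2 statements merged into one kernel-verified Lean document; each statement's English description precedes it below -/
import Mathlib

section
/- Let x* ∈ ℝ^n with ‖x*‖ = 1, let a_1, …, a_m be i.i.d. standard Gaussian random vectors in ℝ^n, and set y_i = sign(⟨a_i, x*⟩). For x ∈ ℝ^n define f_{x*}(x) = (1/m) Σ_{i=1}^m y_i ⟨a_i, x⟩. Then for every t > 0 and every bounded subset T of the closed unit ball of ℝ^n, ℙ{ sup_{x,x' ∈ T} | f_{x*}(x − x') − E[f_{x*}(x − x')] | ≥ 4 W(T)/√m + t } ≤ 4 exp(−m t² / 8), where W(T) is the Gaussian mean width of T. -/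
open MeasureTheory ProbabilityTheory

noncomputable section

/-- Euclidean norm on `Fin n → ℝ`. -/
def evNorm {n : ℕ} (x : Fin n → ℝ) : ℝ := Real.sqrt (∑ i, x i ^ 2)

/-- Euclidean inner product on `Fin n → ℝ`. -/
def evInner {n : ℕ} (u v : Fin n → ℝ) : ℝ := ∑ i, u i * v i

/-- The sign function: `+1` if `p > 0` and `-1` if `p ≤ 0`. -/
def sgn (p : ℝ) : ℝ := if 0 < p then 1 else -1

/-- The law of a standard Gaussian random vector in `ℝ^n` (i.i.d. `N(0,1)` coordinates). -/
def stdGaussianVec (n : ℕ) : Measure (Fin n → ℝ) :=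
  Measure.pi fun _ => gaussianReal 0 1

/-- The law of an `m × n` random matrix with i.i.d. `N(0,1)` entries; `A i` is the `i`-th row. -/
def stdGaussianMatrix (m n : ℕ) : Measure (Fin m → Fin n → ℝ) :=
  Measure.pi fun _ => stdGaussianVec n

/-- The Gaussian mean width of a set `T ⊆ ℝ^n`:
`W(T) = E_g [ sup_{x, x' ∈ T} ⟨g, x - x'⟩ ]` for `g` standard Gaussian. -/
def meanWidth {n : ℕ} (T : Set (Fin n → ℝ)) : ℝ :=
  ∫ g, sSup {t : ℝ | ∃ x ∈ T, ∃ x' ∈ T, t = evInner g (x - x')} ∂ stdGaussianVec n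

/-- `f_{x*}(x) = (1/m) ∑ i, sign(⟨a_i, x*⟩) ⟨a_i, x⟩`. -/
def corrFun {m n : ℕ} (xstar : Fin n → ℝ) (A : Fin m → Fin n → ℝ) (x : Fin n → ℝ) : ℝ :=
  (1 / (m : ℝ)) * ∑ i, sgn (evInner (A i) xstar) * evInner (A i) x

/-- Quadratic upper bound for the exponential with a third-order remainder. -/
lemma Real.exp_le_quadratic_add (d : ℝ) :
    Real.exp d ≤ 1 + d + d ^ 2 / 2 + |d| ^ 3 * Real.exp |d| := by
  have h := Complex.norm_exp_sub_sum_le_norm_mul_exp (d : ℂ) 3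
  simp only [Finset.sum_range_succ, Finset.sum_range_zero] at h
  norm_num at h
  have h2 : Complex.exp d - (1 + d + (d : ℂ) ^ 2 / 2) =
      ((Real.exp d - (1 + d + d ^ 2 / 2) : ℝ) : ℂ) := by push_cast; ring
  rw [h2, Complex.norm_real] at h
  have := (le_abs_self _).trans h
  linarith

section Concentration

variable {E : Type*} [NormedAddCommGroup E] [InnerProductSpace ℝ E] [FiniteDimensional ℝ E]
  [MeasurableSpace E] [BorelSpace E]

/-- The norm has exponential moments of every order under the standard Gaussian measure. -/
lemma integrable_exp_mul_norm_stdGaussian (a : ℝ) :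
    Integrable (fun y : E => Real.exp (a * ‖y‖)) (stdGaussian E) := by
  obtain ⟨C, hC, hint⟩ := IsGaussian.exists_integrable_exp_sq (stdGaussian E)
  refine (hint.const_mul (Real.exp (a ^ 2 / (4 * C)))).mono' (by fun_prop) (ae_of_all _ fun y => ?_)
  rw [Real.norm_eq_abs, abs_of_pos (Real.exp_pos _), ← Real.exp_add]
  refine Real.exp_le_exp.2 ?_
  have : a ^ 2 / (4 * C) + C * ‖y‖ ^ 2 - a * ‖y‖ = (a - 2 * C * ‖y‖) ^ 2 / (4 * C) := by
    field_simp; ring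
  have : 0 ≤ (a - 2 * C * ‖y‖) ^ 2 / (4 * C) := by positivity
  linarith

lemma integrable_norm_stdGaussian : Integrable (fun y : E => ‖y‖) (stdGaussian E) :=
  (IsGaussian.integrable_id (μ := stdGaussian E)).norm

lemma integrable_norm_sq_stdGaussian : Integrable (fun y : E => ‖y‖ ^ 2) (stdGaussian E) :=
  (IsGaussian.memLp_two_id (μ := stdGaussian E)).integrable_norm_pow (by norm_num)

/-- `F` is `L`-Lipschitz and has a linear approximation at every point, up to an error which is
quadratic with constant `M`. -/
def IsSmoothLipschitz (L M : ℝ) (F : E → ℝ) : Prop :=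
  (∀ x y, |F x - F y| ≤ L * ‖x - y‖) ∧
    ∃ G : E → StrongDual ℝ E, Continuous G ∧ (∀ x, ‖G x‖ ≤ L) ∧
      ∀ x v, |F (x + v) - F x - G x v| ≤ M * ‖v‖ ^ 2

omit [InnerProductSpace ℝ E] [FiniteDimensional ℝ E] [MeasurableSpace E] [BorelSpace E] in
lemma continuous_of_abs_sub_le {L : ℝ} {F : E → ℝ} (hF : ∀ x y, |F x - F y| ≤ L * ‖x - y‖) :
    Continuous F :=
  (LipschitzWith.of_dist_le_mul (K := L.toNNReal) fun x y => by
    rw [Real.dist_eq, dist_eq_norm]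
    exact (hF x y).trans (by gcongr; exact Real.le_coe_toNNReal L)).continuous

lemma integrable_comp_add_smul {L : ℝ} {F : E → ℝ} (hF : ∀ x y, |F x - F y| ≤ L * ‖x - y‖)
    (x : E) (s : ℝ) : Integrable (fun y => F (x + s • y)) (stdGaussian E) := by
  have hc := continuous_of_abs_sub_le hF
  refine ((integrable_norm_stdGaussian (E := E)).const_mul (L * |s|) |>.add
    (integrable_const |F x|)).mono' (by fun_prop) (ae_of_all _ fun y => ?_)
  have h := hF (x + s • y) x
  rw [add_sub_cancel_left, norm_smul, Real.norm_eq_abs] at h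
  have := abs_sub_abs_le_abs_sub (F (x + s • y)) (F x)
  simp only [Pi.add_apply, Real.norm_eq_abs]
  linarith

lemma integrable_exp_comp_add_smul {L : ℝ} {F : E → ℝ}
    (hF : ∀ x y, |F x - F y| ≤ L * ‖x - y‖) (x : E) (s : ℝ) :
    Integrable (fun y => Real.exp (F (x + s • y))) (stdGaussian E) := by
  have hc := continuous_of_abs_sub_le hF
  refine ((integrable_exp_mul_norm_stdGaussian (E := E) (L * |s|)).const_mul
    (Real.exp (F x))).mono' (by fun_prop) (ae_of_all _ fun y => ?_)
  rw [Real.norm_eq_abs, abs_of_pos (Real.exp_pos _), ← Real.exp_add]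
  refine Real.exp_le_exp.2 ?_
  have h := hF (x + s • y) x
  rw [add_sub_cancel_left, norm_smul, Real.norm_eq_abs] at h
  linarith [le_abs_self (F (x + s • y) - F x)]

lemma IsSmoothLipschitz.average {L M : ℝ} {F : E → ℝ} (hF : IsSmoothLipschitz L M F) (s : ℝ) :
    IsSmoothLipschitz L M (fun x => ∫ y, F (x + s • y) ∂stdGaussian E) := by
  obtain ⟨hL, G, hGc, hGL, hGM⟩ := hF
  have hi := integrable_comp_add_smul hL
  have hGi (x : E) : Integrable (fun y => G (x + s • y)) (stdGaussian E) :=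
    (integrable_const L).mono' (by fun_prop) (ae_of_all _ fun y => hGL _)
  refine ⟨fun x y => ?_, fun x => ∫ y, G (x + s • y) ∂stdGaussian E, ?_, fun x => ?_,
    fun x v => ?_⟩
  · rw [← integral_sub (hi x s) (hi y s), ← Real.norm_eq_abs]
    refine (norm_integral_le_of_norm_le_const (C := L * ‖x - y‖)
      (ae_of_all _ fun z => ?_)).trans (by simp)
    rw [Real.norm_eq_abs]
    exact (hL _ _).trans (by rw [add_sub_add_right_eq_sub])
  · exact continuous_of_dominated (bound := fun _ => L) (fun x => (hGi x).1)
      (fun x => ae_of_all _ fun y => hGL _) (integrable_const _)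
      (ae_of_all _ fun y => by fun_prop)
  · exact (norm_integral_le_of_norm_le_const (C := L)
      (ae_of_all _ fun z => hGL _)).trans (by simp)
  · rw [ContinuousLinearMap.integral_apply (hGi x), ← integral_sub (hi _ s) (hi _ s),
      ← integral_sub (f := fun y => F (x + v + s • y) - F (x + s • y))
        ((hi _ s).sub (hi _ s)) ((hGi x).apply_continuousLinearMap v),
      ← Real.norm_eq_abs]
    refine (norm_integral_le_of_norm_le_const (C := M * ‖v‖ ^ 2)
      (ae_of_all _ fun z => ?_)).trans (by simp)
    rw [Real.norm_eq_abs, add_right_comm]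
    exact hGM _ _

lemma integral_comp_sqrt_two {φ : E → ℝ} (x : E) (s : ℝ)
    (hi : Integrable (fun y => φ (x + (√2 * s) • y)) (stdGaussian E)) :
    Integrable (fun p : E × E => φ (x + s • p.1 + s • p.2))
      ((stdGaussian E).prod (stdGaussian E)) ∧
    ∫ y, φ (x + (√2 * s) • y) ∂stdGaussian E =
      ∫ y, ∫ z, φ (x + s • y + s • z) ∂stdGaussian E ∂stdGaussian E := by
  set γ := stdGaussian E
  have hrot : (γ.prod γ).map (ContinuousLinearMap.rotation (Real.pi / 4)) = γ.prod γ :=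
    IsGaussian.map_rotation_eq_self (by simp [γ]) _
  have hmp : MeasurePreserving (fun p : E × E => (√2)⁻¹ • p.1 + (√2)⁻¹ • p.2) (γ.prod γ) γ := by
    have h1 : MeasurePreserving (ContinuousLinearMap.rotation (Real.pi / 4))
      (γ.prod γ) (γ.prod γ) := ⟨by fun_prop, hrot⟩
    have h2 := (measurePreserving_fst (μ := γ) (ν := γ)).comp h1
    convert h2 using 1
    ext p
    simp [ContinuousLinearMap.rotation_apply, Real.cos_pi_div_four, Real.sin_pi_div_four,
      Real.sqrt_div_self]
  have heq : (fun p : E × E => φ (x + s • p.1 + s • p.2)) =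
      (fun y => φ (x + (√2 * s) • y)) ∘ (fun p : E × E => (√2)⁻¹ • p.1 + (√2)⁻¹ • p.2) := by
    ext p
    have : √2 * s * (√2)⁻¹ = s := by field_simp
    simp only [Function.comp, smul_add, smul_smul, this, add_assoc]
  have hint : Integrable (fun p : E × E => φ (x + s • p.1 + s • p.2)) (γ.prod γ) := by
    rw [heq]; exact (hmp.integrable_comp hi.1).2 hi
  refine ⟨hint, ?_⟩
  rw [← integral_prod _ hint, heq]
  have := integral_map (μ := γ.prod γ) hmp.measurable.aemeasurable (f := fun y => φ (x + (√2 * s) • y))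
    (by rw [hmp.map_eq]; exact hi.1)
  rw [hmp.map_eq] at this
  exact this

lemma exp_integral_bound_double {L M s c : ℝ}
    (h : ∀ F : E → ℝ, IsSmoothLipschitz L M F → ∀ x,
      ∫ y, Real.exp (F (x + s • y)) ∂stdGaussian E ≤
        Real.exp (∫ y, F (x + s • y) ∂stdGaussian E + c))
    (F : E → ℝ) (hF : IsSmoothLipschitz L M F) (x : E) :
    ∫ y, Real.exp (F (x + (√2 * s) • y)) ∂stdGaussian E ≤
      Real.exp (∫ y, F (x + (√2 * s) • y) ∂stdGaussian E + 2 * c) := by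
  obtain ⟨hi1, he1⟩ := integral_comp_sqrt_two (φ := fun z => Real.exp (F z)) x s
    (integrable_exp_comp_add_smul hF.1 x _)
  obtain ⟨hi2, he2⟩ := integral_comp_sqrt_two x s (integrable_comp_add_smul hF.1 x _)
  have hA := hF.average s
  rw [he1, he2]
  calc _ ≤ ∫ y, Real.exp c * Real.exp (∫ z, F (x + s • y + s • z) ∂stdGaussian E)
            ∂stdGaussian E := by
        refine integral_mono hi1.integral_prod_left
          ((integrable_exp_comp_add_smul hA.1 x s).const_mul _) fun y => ?_
        simpa [Real.exp_add, mul_comm] using h F hF (x + s • y)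
    _ ≤ Real.exp c * Real.exp (∫ y, ∫ z, F (x + s • y + s • z) ∂stdGaussian E
            ∂stdGaussian E + c) := by
        rw [integral_const_mul]
        gcongr
        exact h _ hA x
    _ = _ := by rw [← Real.exp_add]; ring_nf

/-- Pointwise third-order control of `exp D` when `D` is close to its linear part `l`. -/
lemma exp_le_of_linear_approx {L M ε s D l : ℝ} (hL : 0 ≤ L) (hM : 0 ≤ M) (hε0 : 0 ≤ ε)
    (hε1 : ε ≤ 1) (hs0 : 0 ≤ s) (hDs : |D| ≤ L * ε * s) (hls : |l| ≤ L * ε * s)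
    (hqs : |D - l| ≤ M * ε ^ 2 * s ^ 2) :
    Real.exp D ≤ 1 + D + l ^ 2 / 2 +
      ε ^ 3 * ((6 * L * M + 12 * M ^ 2 + 6 * L ^ 3) * Real.exp ((L + 1) * s)) := by
  have hes : Real.exp |D| ≤ Real.exp (L * s) := by
    refine Real.exp_le_exp.2 (hDs.trans ?_)
    have : 0 ≤ L * s := by positivity
    nlinarith
  have hD3 : |D| ^ 3 * Real.exp |D| ≤ (L * ε * s) ^ 3 * Real.exp (L * s) := by gcongr
  have hD2 : D ^ 2 ≤ l ^ 2 + 2 * ((L * ε * s) * (M * ε ^ 2 * s ^ 2))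
      + (M * ε ^ 2 * s ^ 2) ^ 2 := by
    have h1 : l * (D - l) ≤ (L * ε * s) * (M * ε ^ 2 * s ^ 2) :=
      (le_abs_self _).trans (by rw [abs_mul]; gcongr)
    have h2 : (D - l) ^ 2 ≤ (M * ε ^ 2 * s ^ 2) ^ 2 := by
      rw [← sq_abs]; gcongr
    linarith [show D ^ 2 = l ^ 2 + 2 * (l * (D - l)) + (D - l) ^ 2 by ring]
  have hs3 : s ^ 3 ≤ 6 * Real.exp s := by
    have := Real.pow_div_factorial_le_exp s hs0 3
    simp [Nat.factorial] at this; linarith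
  have hs4 : s ^ 4 ≤ 24 * Real.exp s := by
    have := Real.pow_div_factorial_le_exp s hs0 4
    simp [Nat.factorial] at this; linarith
  have hLs : Real.exp s ≤ Real.exp ((L + 1) * s) :=
    Real.exp_le_exp.2 (by linarith [show 0 ≤ L * s by positivity])
  have hε4 : ε ^ 4 ≤ ε ^ 3 := pow_le_pow_of_le_one hε0 hε1 (by norm_num)
  have e1 : L * M * ε ^ 3 * s ^ 3 ≤ L * M * ε ^ 3 * (6 * Real.exp ((L + 1) * s)) := by
    gcongr; linarith
  have e2 : M ^ 2 * ε ^ 4 * s ^ 4 ≤ M ^ 2 * ε ^ 3 * (24 * Real.exp ((L + 1) * s)) := by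
    gcongr; linarith
  have e3 : L ^ 3 * ε ^ 3 * (s ^ 3 * Real.exp (L * s)) ≤
      L ^ 3 * ε ^ 3 * (6 * Real.exp ((L + 1) * s)) := by
    rw [show (L + 1) * s = s + L * s by ring, Real.exp_add, ← mul_assoc 6]
    gcongr
  have := Real.exp_le_quadratic_add D
  linarith

/-- At a small scale, the exponential moment bound holds up to a third-order error. -/
lemma exp_integral_le_one_step {L M : ℝ} (hL : 0 ≤ L) (hM : 0 ≤ M) :
    ∃ C : ℝ, ∀ ε : ℝ, 0 ≤ ε → ε ≤ 1 → ∀ F : E → ℝ, IsSmoothLipschitz L M F → ∀ x,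
      ∫ y, Real.exp (F (x + ε • y)) ∂stdGaussian E ≤
        Real.exp (∫ y, F (x + ε • y) ∂stdGaussian E + (ε ^ 2 * L ^ 2 / 2 + C * ε ^ 3)) := by
  set γ := stdGaussian E
  set v := ∫ y, ‖y‖ ^ 2 ∂γ with hv
  set κ := 1 + v with hκ
  have hv0 : 0 ≤ v := integral_nonneg fun y => by positivity
  have hκv : v ≤ κ ^ 2 := by nlinarith
  have hκ1 : ∫ y, ‖y‖ ∂γ ≤ κ := by
    calc ∫ y, ‖y‖ ∂γ ≤ ∫ y, (1 + ‖y‖ ^ 2) ∂γ :=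
          integral_mono integrable_norm_stdGaussian
            ((integrable_const 1).add integrable_norm_sq_stdGaussian)
            fun y => by nlinarith [sq_nonneg (‖y‖ - 1)]
      _ = κ := by
        rw [integral_add (integrable_const 1) integrable_norm_sq_stdGaussian]; simp [hκ, hv, γ]
  set B : E → ℝ := fun y => (6 * L * M + 12 * M ^ 2 + 6 * L ^ 3) * Real.exp ((L + 1) * (‖y‖ + κ))
    with hB
  have hBi : Integrable B γ := by
    have := (integrable_exp_mul_norm_stdGaussian (E := E) (L + 1)).const_mul
      ((6 * L * M + 12 * M ^ 2 + 6 * L ^ 3) * Real.exp ((L + 1) * κ))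
    refine this.congr (ae_of_all _ fun y => ?_)
    simp only [hB, mul_add, Real.exp_add]; ring
  refine ⟨∫ y, B y ∂γ, fun ε hε0 hε1 F ⟨hFL, G, _, hGL, hGM⟩ x => ?_⟩
  have hFi := integrable_comp_add_smul hFL x ε
  set m := ∫ y, F (x + ε • y) ∂γ with hm
  have hGi : Integrable (fun y => ε * G x y) γ :=
    (IsGaussian.integrable_dual γ (G x)).const_mul ε
  have hG0 : ∫ y, ε * G x y ∂γ = 0 := by
    rw [integral_const_mul]; simp [γ]
  have hGsqi : Integrable (fun y => (ε * G x y) ^ 2) γ := by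
    simp_rw [mul_pow]
    exact ((IsGaussian.memLp_dual γ (G x) 2 (by simp)).integrable_sq).const_mul _
  have hGsq : ∫ y, (ε * G x y) ^ 2 ∂γ = ε ^ 2 * ‖G x‖ ^ 2 := by
    simp_rw [mul_pow]
    rw [integral_const_mul, ← variance_dual_stdGaussian,
      variance_of_integral_eq_zero (by fun_prop) (by simp)]
  have hFx : |F x - m| ≤ L * ε * κ := by
    have h1 : F x - m = ∫ y, (F x - F (x + ε • y)) ∂γ := by
      rw [integral_sub (integrable_const _) hFi]; simp [hm, γ]
    rw [h1, ← Real.norm_eq_abs]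
    refine (norm_integral_le_of_norm_le (integrable_norm_stdGaussian.const_mul (L * ε))
      (ae_of_all _ fun y => ?_)).trans ?_
    · have := hFL x (x + ε • y)
      rw [Real.norm_eq_abs]
      rwa [sub_add_cancel_left, norm_neg, norm_smul, Real.norm_of_nonneg hε0, ← mul_assoc] at this
    · rw [integral_const_mul]; gcongr
  have hq (y : E) : |F (x + ε • y) - F x - ε * G x y| ≤ M * ε ^ 2 * ‖y‖ ^ 2 := by
    have := hGM x (ε • y)
    rw [map_smul, smul_eq_mul, norm_smul, Real.norm_of_nonneg hε0] at this
    linarith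
  have hqx : |F x - m| ≤ M * ε ^ 2 * κ ^ 2 := by
    have h1 : m - F x = ∫ y, (F (x + ε • y) - F x - ε * G x y) ∂γ := by
      rw [integral_sub (f := fun y => F (x + ε • y) - F x) (hFi.sub (integrable_const _)) hGi,
        integral_sub hFi (integrable_const _), hG0]
      simp [hm, γ]
    rw [abs_sub_comm, h1, ← Real.norm_eq_abs]
    refine (norm_integral_le_of_norm_le (integrable_norm_sq_stdGaussian.const_mul (M * ε ^ 2))
      (ae_of_all _ fun y => hq y)).trans ?_
    rw [integral_const_mul]; gcongr
  have key (y : E) : Real.exp (F (x + ε • y) - m) ≤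
      1 + (F (x + ε • y) - m) + (ε * G x y) ^ 2 / 2 + ε ^ 3 * B y := by
    set D := F (x + ε • y) - m with hD
    set l := ε * G x y with hl
    set s := ‖y‖ + κ with hs
    have hs0 : 0 ≤ s := by positivity
    have hDs : |D| ≤ L * ε * s := by
      have h1 := hFL (x + ε • y) x
      rw [add_sub_cancel_left, norm_smul, Real.norm_of_nonneg hε0] at h1
      have : D = (F (x + ε • y) - F x) + (F x - m) := by ring
      rw [this]
      refine (abs_add_le _ _).trans ?_
      rw [hs]; linarith
    have hls : |l| ≤ L * ε * s := by
      have h1 : |G x y| ≤ L * ‖y‖ := by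
        rw [← Real.norm_eq_abs]
        exact ((G x).le_opNorm y).trans (by gcongr; exact hGL x)
      have h2 : ‖y‖ ≤ s := by rw [hs]; linarith
      rw [hl, abs_mul, abs_of_nonneg hε0]
      calc ε * |G x y| ≤ ε * (L * s) := by gcongr; exact h1.trans (by gcongr)
        _ = _ := by ring
    have hqs : |D - l| ≤ M * ε ^ 2 * s ^ 2 := by
      have : D - l = (F (x + ε • y) - F x - ε * G x y) + (F x - m) := by rw [hD, hl]; ring
      rw [this]
      refine (abs_add_le _ _).trans ?_
      have h1 : ‖y‖ ^ 2 + κ ^ 2 ≤ s ^ 2 := by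
        rw [hs]; nlinarith [norm_nonneg y]
      have h2 : M * ε ^ 2 * (‖y‖ ^ 2 + κ ^ 2) ≤ M * ε ^ 2 * s ^ 2 := by gcongr
      linarith [hq y]
    refine (exp_le_of_linear_approx hL hM hε0 hε1 hs0 hDs hls hqs).trans_eq ?_
    simp only [hB, ← hs]
  have hint : ∫ y, Real.exp (F (x + ε • y) - m) ∂γ ≤ 1 + ε ^ 2 * ‖G x‖ ^ 2 / 2
      + ε ^ 3 * ∫ y, B y ∂γ := by
    have i0 : Integrable (fun y => F (x + ε • y) - m) γ := hFi.sub (integrable_const _)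
    have i1 : Integrable (fun y => 1 + (F (x + ε • y) - m)) γ := (integrable_const _).add i0
    have i2 : Integrable (fun y => 1 + (F (x + ε • y) - m) + (ε * G x y) ^ 2 / 2) γ :=
      i1.add (hGsqi.div_const 2)
    refine (integral_mono (by
      simpa [Real.exp_sub] using (integrable_exp_comp_add_smul hFL x ε).div_const (Real.exp m))
      (i2.add (hBi.const_mul _)) key).trans_eq ?_
    simp only [Pi.add_apply]
    rw [integral_add i2 (hBi.const_mul _), integral_add i1 (hGsqi.div_const 2),
      integral_add (integrable_const _) i0,
      integral_sub hFi (integrable_const _), integral_div, hGsq, integral_const_mul]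
    simp [hm, γ]
  have hGx : ‖G x‖ ^ 2 ≤ L ^ 2 := by gcongr; exact hGL x
  have h3 : ∫ y, Real.exp (F (x + ε • y)) ∂γ
      = Real.exp m * ∫ y, Real.exp (F (x + ε • y) - m) ∂γ := by
    rw [← integral_const_mul]
    simp [← Real.exp_add]
  rw [h3, Real.exp_add]
  gcongr
  refine hint.trans (le_trans ?_ (Real.add_one_le_exp _))
  have : ε ^ 2 * ‖G x‖ ^ 2 ≤ ε ^ 2 * L ^ 2 := by gcongr
  linarith

/-- Sharp exponential moment bound for smooth Lipschitz functions of a Gaussian vector. -/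
lemma IsSmoothLipschitz.exp_integral_le {L M : ℝ} (hL : 0 ≤ L) (hM : 0 ≤ M) {F : E → ℝ}
    (hF : IsSmoothLipschitz L M F) :
    ∫ y, Real.exp (F y) ∂stdGaussian E ≤ Real.exp (∫ y, F y ∂stdGaussian E + L ^ 2 / 2) := by
  obtain ⟨C, hC⟩ := exp_integral_le_one_step (E := E) hL hM
  have step (ε : ℝ) (hε0 : 0 ≤ ε) (hε1 : ε ≤ 1) (k : ℕ) :
      ∀ F : E → ℝ, IsSmoothLipschitz L M F → ∀ x,
      ∫ y, Real.exp (F (x + (√2 ^ k * ε) • y)) ∂stdGaussian E ≤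
        Real.exp (∫ y, F (x + (√2 ^ k * ε) • y) ∂stdGaussian E +
          2 ^ k * (ε ^ 2 * L ^ 2 / 2 + C * ε ^ 3)) := by
    induction k with
    | zero => simpa using hC ε hε0 hε1
    | succ k ih =>
      intro F hF x
      have := exp_integral_bound_double ih F hF x
      rw [pow_succ', pow_succ', mul_assoc, mul_assoc]
      exact this
  have h2 : 1 < √2 := by
    rw [Real.lt_sqrt (by norm_num)]; norm_num
  have bound (k : ℕ) : ∫ y, Real.exp (F y) ∂stdGaussian E ≤
      Real.exp (∫ y, F y ∂stdGaussian E + (L ^ 2 / 2 + C * (√2)⁻¹ ^ k)) := by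
    have h := step ((√2)⁻¹ ^ k) (by positivity)
      (pow_le_one₀ (by positivity) (inv_le_one_of_one_le₀ h2.le)) k F hF 0
    have e1 : √2 ^ k * (√2)⁻¹ ^ k = 1 := by rw [← mul_pow]; field_simp; simp
    have e2 : (2 : ℝ) ^ k * ((√2)⁻¹ ^ k) ^ 2 = 1 := by
      rw [← pow_mul, mul_comm k 2, pow_mul, inv_pow, Real.sq_sqrt (by norm_num), ← mul_pow]
      norm_num
    rw [e1] at h
    simp only [zero_add, one_smul] at h
    convert h using 3
    linear_combination (-L ^ 2 / 2 - C * (√2)⁻¹ ^ k) * e2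
  refine ge_of_tendsto' (f := fun k : ℕ => Real.exp (∫ y, F y ∂stdGaussian E +
    (L ^ 2 / 2 + C * (√2)⁻¹ ^ k))) (x := Filter.atTop) ?_ bound
  have := tendsto_pow_atTop_nhds_zero_of_lt_one (r := (√2)⁻¹) (by positivity)
    (inv_lt_one_of_one_lt₀ h2)
  have h4 := (((this.const_mul C).const_add (L ^ 2 / 2)).const_add
    (∫ y, F y ∂stdGaussian E)).rexp
  simpa using h4

omit [InnerProductSpace ℝ E] [FiniteDimensional ℝ E] in
lemma norm_convolution_sub_le [NormedSpace ℝ E] {V W : Type*} [NormedAddCommGroup V] [NormedSpace ℝ V]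
    [NormedAddCommGroup W] [NormedSpace ℝ W] [CompleteSpace W]
    {μ : Measure E} [IsFiniteMeasureOnCompacts μ]
    (B : V →L[ℝ] ℝ →L[ℝ] W) {ψ : E → V} (hψ : Continuous ψ) (hs : HasCompactSupport ψ)
    {L : ℝ} {F : E → ℝ} (hF : ∀ x y, |F x - F y| ≤ L * ‖x - y‖) (x y : E) :
    ‖(convolution ψ F B μ) x - (convolution ψ F B μ) y‖ ≤
      ‖B‖ * (∫ t, ‖ψ t‖ ∂μ) * (L * ‖x - y‖) := by
  have hc := continuous_of_abs_sub_le hF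
  have hi (x : E) : Integrable (fun t => B (ψ t) (F (x - t))) μ := by
    refine Continuous.integrable_of_hasCompactSupport (by fun_prop) (hs.mono fun t ht => ?_)
    contrapose! ht
    simp at ht
    simp [ht]
  have hψi : Integrable (fun t => ‖ψ t‖) μ :=
    (hψ.integrable_of_hasCompactSupport hs).norm
  rw [convolution, convolution, ← integral_sub (hi x) (hi y)]
  refine (norm_integral_le_of_norm_le (hψi.const_mul (‖B‖ * (L * ‖x - y‖)))
    (ae_of_all _ fun t => ?_)).trans_eq ?_
  · rw [← map_sub]
    refine (B.le_opNorm₂ _ _).trans ?_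
    have := hF (x - t) (y - t)
    rw [sub_sub_sub_cancel_right] at this
    rw [Real.norm_eq_abs]
    calc ‖B‖ * ‖ψ t‖ * |F (x - t) - F (y - t)| ≤ ‖B‖ * ‖ψ t‖ * (L * ‖x - y‖) := by gcongr
      _ = _ := by ring
  · rw [integral_const_mul]; ring

/-- Lipschitz functions are uniform limits of smooth ones with the same Lipschitz constant. -/
lemma exists_isSmoothLipschitz_near {L : ℝ} (hL : 0 ≤ L) {F : E → ℝ}
    (hF : ∀ x y, |F x - F y| ≤ L * ‖x - y‖) {δ : ℝ} (hδ : 0 < δ) :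
    ∃ M, 0 ≤ M ∧ ∃ F' : E → ℝ, IsSmoothLipschitz L M F' ∧ ∀ x, |F' x - F x| ≤ δ := by
  have hc := continuous_of_abs_sub_le hF
  set μ : Measure E := Measure.addHaar
  have hr : 0 < δ / (L + 1) := by positivity
  let φ : ContDiffBump (0 : E) := ⟨δ / (L + 1) / 2, δ / (L + 1), by positivity, by linarith⟩
  have hcd : ContDiff ℝ 1 (φ.normed μ) := φ.contDiff_normed
  have hcs : HasCompactSupport (φ.normed μ) := φ.hasCompactSupport_normed
  set B := ContinuousLinearMap.lsmul ℝ ℝ (E := ℝ)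
  set F' : E → ℝ := convolution (φ.normed μ) F B μ
  set B' := B.precompL E
  set G : E → StrongDual ℝ E := convolution (fderiv ℝ (φ.normed μ)) F B' μ
  have hG (x : E) : HasFDerivAt F' (G x) x :=
    hcs.hasFDerivAt_convolution_left B hcd (hc.locallyIntegrable) x
  have hF' (x y : E) : |F' x - F' y| ≤ L * ‖x - y‖ := by
    have h := norm_convolution_sub_le (μ := μ) B hcd.continuous hcs hF x y
    have h1 : ∫ t, ‖φ.normed μ t‖ ∂μ = 1 := by
      simp_rw [Real.norm_of_nonneg (φ.nonneg_normed _)]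
      exact φ.integral_normed
    have h2 : ‖B‖ ≤ 1 := ContinuousLinearMap.opNorm_lsmul_le
    rw [h1, mul_one] at h
    refine h.trans ?_
    have : 0 ≤ L * ‖x - y‖ := by positivity
    nlinarith
  obtain ⟨K₀, hK₀, hG₀⟩ : ∃ K₀ : ℝ, 0 ≤ K₀ ∧ ∀ x y, ‖G x - G y‖ ≤ K₀ * (L * ‖x - y‖) := by
    refine ⟨_, ?_, fun x y => norm_convolution_sub_le (μ := μ) B'
      (hcd.continuous_fderiv one_ne_zero) (hcs.fderiv ℝ) hF x y⟩
    exact mul_nonneg (ContinuousLinearMap.opNorm_nonneg _) (integral_nonneg fun _ => norm_nonneg _)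
  set K := K₀ * L
  have hK0 : 0 ≤ K := mul_nonneg hK₀ hL
  have hG' (x y : E) : ‖G x - G y‖ ≤ K * ‖x - y‖ := by
    simpa only [mul_assoc, K] using hG₀ x y
  have hGc : Continuous G :=
    (LipschitzWith.of_dist_le_mul (K := K.toNNReal) fun x y => by
      rw [dist_eq_norm, dist_eq_norm, Real.coe_toNNReal _ hK0]
      exact hG' x y).continuous
  refine ⟨K, hK0, F', ⟨hF', G, hGc, fun x => ?_, fun x v => ?_⟩, fun x => ?_⟩
  · exact (hG x).le_of_lip' hL (Filter.Eventually.of_forall fun y => by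
      simpa using hF' y x)
  · have h := Convex.norm_image_sub_le_of_norm_hasFDerivWithin_le' (𝕜 := ℝ) (f := F') (f' := G)
      (φ := G x) (s := Metric.closedBall x ‖v‖) (C := K * ‖v‖) (x := x) (y := x + v)
      (fun z _ => (hG z).hasFDerivWithinAt)
      (fun z hz => (hG' z x).trans (by
        gcongr; simpa [dist_eq_norm] using hz))
      (convex_closedBall _ _) (by simp) (by simp)
    rw [add_sub_cancel_left, Real.norm_eq_abs] at h
    linarith
  · rw [← Real.dist_eq]
    refine φ.dist_normed_convolution_le hc.aestronglyMeasurable fun y hy => ?_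
    have h := hF y x
    rw [Metric.mem_ball, dist_eq_norm] at hy
    rw [Real.dist_eq]
    have h3 : L * ‖y - x‖ ≤ L * (δ / (L + 1)) := by gcongr
    have h4 : L * (δ / (L + 1)) ≤ δ := by
      rw [mul_div_assoc', div_le_iff₀ (by positivity)]; nlinarith
    linarith

/-- **Gaussian concentration**: sharp exponential moment bound for Lipschitz functions. -/
theorem exp_integral_le_of_lipschitz {L : ℝ} (hL : 0 ≤ L) {F : E → ℝ}
    (hF : ∀ x y, |F x - F y| ≤ L * ‖x - y‖) :
    ∫ y, Real.exp (F y) ∂stdGaussian E ≤ Real.exp (∫ y, F y ∂stdGaussian E + L ^ 2 / 2) := by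
  have hFi : Integrable F (stdGaussian E) := by
    simpa using integrable_comp_add_smul hF 0 1
  have hFe : Integrable (fun y => Real.exp (F y)) (stdGaussian E) := by
    simpa using integrable_exp_comp_add_smul hF 0 1
  have bound (δ : ℝ) (hδ : 0 < δ) : ∫ y, Real.exp (F y) ∂stdGaussian E ≤
      Real.exp (∫ y, F y ∂stdGaussian E + L ^ 2 / 2 + 2 * δ) := by
    obtain ⟨M, hM, F', hF', hd⟩ := exists_isSmoothLipschitz_near hL hF hδ
    have hF'i : Integrable F' (stdGaussian E) := by
      simpa using integrable_comp_add_smul hF'.1 0 1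
    have hF'e : Integrable (fun y => Real.exp (F' y)) (stdGaussian E) := by
      simpa using integrable_exp_comp_add_smul hF'.1 0 1
    have h1 : ∫ y, F' y ∂stdGaussian E ≤ ∫ y, F y ∂stdGaussian E + δ := by
      refine (integral_mono hF'i (hFi.add (integrable_const δ)) fun y => ?_).trans_eq ?_
      · simp only [Pi.add_apply]; linarith [(abs_le.1 (hd y)).2]
      · rw [integral_add' hFi (integrable_const _)]; simp
    calc ∫ y, Real.exp (F y) ∂stdGaussian E
        ≤ ∫ y, Real.exp δ * Real.exp (F' y) ∂stdGaussian E := by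
          refine integral_mono hFe (hF'e.const_mul _) fun y => ?_
          simp only [← Real.exp_add]
          exact Real.exp_le_exp.2 (by linarith [(abs_le.1 (hd y)).1])
      _ ≤ Real.exp δ * Real.exp (∫ y, F' y ∂stdGaussian E + L ^ 2 / 2) := by
          rw [integral_const_mul]
          gcongr
          exact hF'.exp_integral_le hL hM
      _ ≤ _ := by
          rw [← Real.exp_add]
          exact Real.exp_le_exp.2 (by linarith)
  have ht : Filter.Tendsto (fun δ : ℝ => Real.exp (∫ y, F y ∂stdGaussian E + L ^ 2 / 2 + 2 * δ))
      (nhdsWithin 0 (Set.Ioi 0)) (nhds (Real.exp (∫ y, F y ∂stdGaussian E + L ^ 2 / 2))) := by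
    have : Continuous fun δ : ℝ => Real.exp (∫ y, F y ∂stdGaussian E + L ^ 2 / 2 + 2 * δ) := by
      fun_prop
    simpa using (this.tendsto 0).mono_left nhdsWithin_le_nhds
  exact ge_of_tendsto ht (eventually_nhdsWithin_of_forall bound)

/-- Upper tail of a Lipschitz function of a standard Gaussian vector. -/
theorem stdGaussian_measure_ge_le {L : ℝ} (hL : 0 < L) {F : E → ℝ}
    (hF : ∀ x y, |F x - F y| ≤ L * ‖x - y‖) {t : ℝ} (ht : 0 ≤ t) :
    (stdGaussian E).real {y | ∫ z, F z ∂stdGaussian E + t ≤ F y} ≤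
      Real.exp (-t ^ 2 / (2 * L ^ 2)) := by
  have hlam (c : ℝ) (x y : E) : |c * F x - c * F y| ≤ (|c| * L) * ‖x - y‖ := by
    rw [← mul_sub, abs_mul, mul_assoc]
    gcongr
    exact hF x y
  have hsub : HasSubgaussianMGF (fun y => F y - ∫ z, F z ∂stdGaussian E) (L.toNNReal ^ 2)
      (stdGaussian E) := by
    refine ⟨fun c => ?_, fun c => ?_⟩
    · have := (integrable_exp_comp_add_smul (hlam c) 0 1).div_const
        (Real.exp (c * ∫ z, F z ∂stdGaussian E))
      simpa [mul_sub, Real.exp_sub] using this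
    · have h := exp_integral_le_of_lipschitz (by positivity) (hlam c)
      rw [integral_const_mul] at h
      have h2 : mgf (fun y => F y - ∫ z, F z ∂stdGaussian E) (stdGaussian E) c =
          (∫ y, Real.exp (c * F y) ∂stdGaussian E) *
            Real.exp (-(c * ∫ z, F z ∂stdGaussian E)) := by
        rw [← integral_mul_const]
        simp only [mgf, ← Real.exp_add]
        congr with y
        ring_nf
      rw [h2]
      calc _ ≤ Real.exp (c * ∫ y, F y ∂stdGaussian E + (|c| * L) ^ 2 / 2) *
            Real.exp (-(c * ∫ z, F z ∂stdGaussian E)) := by gcongr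
        _ = _ := by
          rw [← Real.exp_add, mul_pow, sq_abs]
          rw [NNReal.coe_pow, Real.coe_toNNReal _ hL.le]
          congr 1
          ring
  have h := hsub.measure_ge_le ht
  simp only [le_sub_iff_add_le] at h
  rw [NNReal.coe_pow, Real.coe_toNNReal _ hL.le] at h
  simpa [add_comm] using h

end Concentration

section GaussianReal

lemma integrable_id_gaussianReal_zero_one : Integrable (fun x : ℝ => x) (gaussianReal 0 1) :=
  (memLp_id_gaussianReal 1).integrable le_rfl

lemma integral_abs_gaussianReal : ∫ x, |x| ∂gaussianReal 0 1 = Real.sqrt (2 / Real.pi) := by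
  have h := integral_comp_abs (f := fun x : ℝ => (Real.sqrt (2 * Real.pi))⁻¹ *
    (x ^ (1 : ℝ) * Real.exp (-(1 / 2) * x ^ (2 : ℝ))))
  rw [integral_const_mul (μ := volume.restrict _),
    integral_rpow_mul_exp_neg_mul_rpow two_pos (by norm_num) (by norm_num)] at h
  rw [integral_gaussianReal_eq_integral_smul one_ne_zero]
  have h2 : (fun x : ℝ => gaussianPDFReal 0 1 x • |x|) = fun x : ℝ => (Real.sqrt (2 * Real.pi))⁻¹ *
      (|x| ^ (1 : ℝ) * Real.exp (-(1 / 2) * |x| ^ (2 : ℝ))) := by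
    ext x
    simp only [gaussianPDFReal, NNReal.coe_one, sub_zero, mul_one, smul_eq_mul, Real.rpow_one,
      Real.rpow_two, sq_abs]
    rw [show -x ^ 2 / 2 = -(1 / 2) * x ^ 2 by ring]
    ring
  rw [h2, h]
  norm_num
  have h3 : Real.sqrt 2 * Real.sqrt 2 = 2 := by simp
  have : 0 < Real.sqrt Real.pi := Real.sqrt_pos.2 Real.pi_pos
  field_simp
  linarith

lemma integral_sq_gaussianReal : ∫ x, x ^ 2 ∂gaussianReal 0 1 = 1 := by
  have h := variance_eq_sub (memLp_id_gaussianReal (μ := 0) (v := 1) 2)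
  simpa using h.symm

lemma integral_mul_abs_gaussianReal : ∫ x, x * |x| ∂gaussianReal 0 1 = 0 := by
  have h : ∫ x, x * |x| ∂gaussianReal 0 1 = ∫ x, -x * |-x| ∂gaussianReal 0 1 := by
    conv_lhs => rw [← neg_zero (G := ℝ), ← gaussianReal_map_neg]
    rw [integral_map (by fun_prop) (by fun_prop)]
  simp only [abs_neg, neg_mul, integral_neg] at h
  linarith

lemma variance_abs_sub_gaussianReal_le : Var[fun x => |x| - x; gaussianReal 0 1] ≤ 2 := by
  have hm : MemLp (fun x : ℝ => x) 2 (gaussianReal 0 1) := memLp_id_gaussianReal 2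
  have hsq : Integrable (fun x : ℝ => x ^ 2) (gaussianReal 0 1) := hm.integrable_sq
  have hma : Integrable (fun x : ℝ => x * |x|) (gaussianReal 0 1) := hm.integrable_mul hm.abs
  refine (variance_le_expectation_sq (by fun_prop)).trans_eq ?_
  have : ((fun x : ℝ => |x| - x) ^ 2) = fun x => 2 * x ^ 2 - 2 * (x * |x|) := by
    ext x
    simp only [Pi.pow_apply]
    nlinarith [sq_abs x]
  rw [this, integral_sub (hsq.const_mul 2) (hma.const_mul 2), integral_const_mul,
    integral_const_mul, integral_sq_gaussianReal, integral_mul_abs_gaussianReal]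
  norm_num

end GaussianReal

section Fold

variable {E : Type*} [NormedAddCommGroup E] [InnerProductSpace ℝ E]

open scoped RealInnerProductSpace

/-- The map folding `E` onto the half-space `0 ≤ ⟪e, ·⟫` along the hyperplane `eᗮ`. -/
def halfspaceFold (e a : E) : E := a + (|⟪e, a⟫| - ⟪e, a⟫) • e

lemma norm_halfspaceFold_sub_le {e : E} (he : ‖e‖ = 1) (a b : E) :
    ‖halfspaceFold e a - halfspaceFold e b‖ ≤ ‖a - b‖ := by
  have h1 : halfspaceFold e a - halfspaceFold e b =
      (a - b) + ((|⟪e, a⟫| - |⟪e, b⟫|) - (⟪e, a⟫ - ⟪e, b⟫)) • e := by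
    simp only [halfspaceFold]; module
  refine abs_le_of_sq_le_sq' ?_ (norm_nonneg _) |>.2
  rw [h1, norm_add_sq_real, norm_smul, he, inner_smul_right, real_inner_comm e (a - b), inner_sub_right,
    mul_one, Real.norm_eq_abs, sq_abs]
  nlinarith [sq_abs ⟪e, a⟫, sq_abs ⟪e, b⟫, sq_abs (⟪e, a⟫ - ⟪e, b⟫),
    abs_abs_sub_abs_le ⟪e, a⟫ ⟪e, b⟫, sq_abs (|⟪e, a⟫| - |⟪e, b⟫|),
    abs_nonneg (|⟪e, a⟫| - |⟪e, b⟫|), abs_nonneg (⟪e, a⟫ - ⟪e, b⟫),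
    sq_le_sq.2 (abs_abs_sub_abs_le ⟪e, a⟫ ⟪e, b⟫)]

/-- The isometry fixing `e` and changing the sign of its orthogonal complement. -/
abbrev axisReflection (e : E) : E ≃ₗᵢ[ℝ] E := (Submodule.span ℝ {e}).reflection

lemma axisReflection_apply {e : E} (he : ‖e‖ = 1) (a : E) :
    axisReflection e a = (2 * ⟪e, a⟫) • e - a := by
  rw [axisReflection, Submodule.reflection_singleton_apply, he]
  simp [two_smul, two_mul, add_smul]

lemma inner_axisReflection {e : E} (he : ‖e‖ = 1) (a : E) :
    ⟪e, axisReflection e a⟫ = ⟪e, a⟫ := by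
  rw [axisReflection_apply he, inner_sub_right, inner_smul_right, real_inner_self_eq_norm_sq, he]
  ring

open Classical in
/-- Reflect the half-space `⟪e, ·⟫ ≤ 0` about the axis `e`. -/
def halfspaceTwist (e a : E) : E := if 0 < ⟪e, a⟫ then a else axisReflection e a

lemma sgn_smul_halfspaceTwist {e : E} (he : ‖e‖ = 1) (a : E) :
    sgn ⟪e, halfspaceTwist e a⟫ • halfspaceTwist e a = halfspaceFold e a := by
  by_cases h : 0 < ⟪e, a⟫
  · simp [halfspaceTwist, halfspaceFold, sgn, h, abs_of_pos h]
  · rw [halfspaceTwist, if_neg h, inner_axisReflection he, sgn, if_neg h, axisReflection_apply he,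
      halfspaceFold, abs_of_nonpos (not_lt.1 h)]
    module

variable [FiniteDimensional ℝ E] [MeasurableSpace E] [BorelSpace E]

lemma measurePreserving_axisReflection (e : E) :
    MeasurePreserving (axisReflection e) (stdGaussian E) (stdGaussian E) :=
  ⟨(axisReflection e).continuous.measurable, stdGaussian_map (axisReflection e)⟩

lemma measurePreserving_halfspaceTwist {e : E} (he : ‖e‖ = 1) :
    MeasurePreserving (halfspaceTwist e) (stdGaussian E) (stdGaussian E) := by
  have hH : MeasurableSet {a : E | 0 < ⟪e, a⟫} :=
    measurableSet_lt measurable_const (by fun_prop)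
  have hm : Measurable (halfspaceTwist e) :=
    Measurable.ite hH measurable_id (axisReflection e).continuous.measurable
  refine ⟨hm, Measure.ext fun S hS => ?_⟩
  rw [Measure.map_apply hm hS, ← measure_inter_add_sdiff (halfspaceTwist e ⁻¹' S) hH,
    ← measure_inter_add_sdiff S hH]
  congr 1
  · congr 1
    ext a
    simp +contextual [halfspaceTwist, and_congr_left_iff]
  · rw [← (measurePreserving_axisReflection e).measure_preimage (hS.diff hH).nullMeasurableSet]
    congr 1
    ext a
    simp only [Set.mem_sdiff, Set.mem_preimage, Set.mem_ofPred_eq, inner_axisReflection he,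
      halfspaceTwist]
    refine and_congr_left fun h => ?_
    rw [if_neg h]

end Fold

section SupportWidth

variable {E : Type*} [NormedAddCommGroup E] [InnerProductSpace ℝ E]

open scoped RealInnerProductSpace

/-- The width of `T` in the direction `w`. -/
def supportWidth (T : Set E) (w : E) : ℝ :=
  sSup {t : ℝ | ∃ x ∈ T, ∃ x' ∈ T, t = ⟪w, x - x'⟫}

variable {T : Set E}

lemma supportWidth_le (hne : T.Nonempty) {w : E} {c : ℝ}
    (h : ∀ x ∈ T, ∀ x' ∈ T, ⟪w, x - x'⟫ ≤ c) : supportWidth T w ≤ c := by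
  obtain ⟨x, hx⟩ := hne
  refine csSup_le ⟨_, x, hx, x, hx, rfl⟩ ?_
  rintro _ ⟨x, hx, x', hx', rfl⟩
  exact h x hx x' hx'

lemma inner_le_two_mul_norm (hT : ∀ x ∈ T, ‖x‖ ≤ 1) (w : E) {x x' : E} (hx : x ∈ T)
    (hx' : x' ∈ T) : ⟪w, x - x'⟫ ≤ 2 * ‖w‖ := by
  have h : ‖x - x'‖ ≤ 2 := (norm_sub_le _ _).trans (by linarith [hT x hx, hT x' hx'])
  nlinarith [real_inner_le_norm w (x - x'), norm_nonneg w]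

lemma inner_le_supportWidth (hT : ∀ x ∈ T, ‖x‖ ≤ 1) (w : E) {x x' : E} (hx : x ∈ T)
    (hx' : x' ∈ T) : ⟪w, x - x'⟫ ≤ supportWidth T w := by
  refine le_csSup ⟨2 * ‖w‖, ?_⟩ ⟨x, hx, x', hx', rfl⟩
  rintro _ ⟨x, hx, x', hx', rfl⟩
  exact inner_le_two_mul_norm hT w hx hx'

lemma abs_inner_le_supportWidth (hT : ∀ x ∈ T, ‖x‖ ≤ 1) (w : E) {x x' : E} (hx : x ∈ T)
    (hx' : x' ∈ T) : |⟪w, x - x'⟫| ≤ supportWidth T w := by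
  refine abs_le'.2 ⟨inner_le_supportWidth hT w hx hx', ?_⟩
  rw [← inner_neg_right, neg_sub]
  exact inner_le_supportWidth hT w hx' hx

lemma supportWidth_nonneg (hT : ∀ x ∈ T, ‖x‖ ≤ 1) (hne : T.Nonempty) (w : E) :
    0 ≤ supportWidth T w := by
  obtain ⟨x, hx⟩ := hne
  simpa using inner_le_supportWidth hT w hx hx

lemma supportWidth_add_le (hT : ∀ x ∈ T, ‖x‖ ≤ 1) (hne : T.Nonempty) (u v : E) :
    supportWidth T (u + v) ≤ supportWidth T u + supportWidth T v :=
  supportWidth_le hne fun x hx x' hx' => by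
    rw [inner_add_left]
    exact add_le_add (inner_le_supportWidth hT u hx hx') (inner_le_supportWidth hT v hx hx')

lemma supportWidth_smul_le (hT : ∀ x ∈ T, ‖x‖ ≤ 1) (hne : T.Nonempty) (c : ℝ) (w : E) :
    supportWidth T (c • w) ≤ |c| * supportWidth T w :=
  supportWidth_le hne fun x hx x' hx' => by
    rw [real_inner_smul_left]
    refine (le_abs_self _).trans ?_
    rw [abs_mul]
    gcongr
    exact abs_inner_le_supportWidth hT w hx hx'

lemma supportWidth_smul (hT : ∀ x ∈ T, ‖x‖ ≤ 1) (hne : T.Nonempty) (c : ℝ) (w : E) :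
    supportWidth T (c • w) = |c| * supportWidth T w := by
  refine (supportWidth_smul_le hT hne c w).antisymm ?_
  rcases eq_or_ne c 0 with rfl | hc
  · simpa using supportWidth_nonneg hT hne _
  · have h := supportWidth_smul_le hT hne c⁻¹ (c • w)
    rw [inv_smul_smul₀ hc, abs_inv] at h
    rwa [mul_comm, ← le_div_iff₀ (abs_pos.2 hc), div_eq_inv_mul]

lemma abs_supportWidth_sub_le (hT : ∀ x ∈ T, ‖x‖ ≤ 1) (hne : T.Nonempty) (u v : E) :
    |supportWidth T u - supportWidth T v| ≤ 2 * ‖u - v‖ := by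
  have h (u v : E) : supportWidth T u ≤ supportWidth T v + 2 * ‖u - v‖ := by
    have h1 := supportWidth_add_le hT hne v (u - v)
    have h2 : supportWidth T (u - v) ≤ 2 * ‖u - v‖ :=
      supportWidth_le hne fun x hx x' hx' => inner_le_two_mul_norm hT _ hx hx'
    rw [add_sub_cancel] at h1
    linarith
  have h1 := h u v
  have h2 := h v u
  rw [norm_sub_rev v u] at h2
  exact abs_le.2 ⟨by linarith, by linarith⟩

variable [FiniteDimensional ℝ E] [MeasurableSpace E] [BorelSpace E]

lemma integrable_supportWidth (hT : ∀ x ∈ T, ‖x‖ ≤ 1) (hne : T.Nonempty) :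
    Integrable (supportWidth T) (stdGaussian E) := by
  simpa using integrable_comp_add_smul (abs_supportWidth_sub_le hT hne) 0 1

lemma map_inner_stdGaussian {e : E} (he : ‖e‖ = 1) :
    MeasurePreserving (fun a : E => ⟪e, a⟫) (stdGaussian E) (gaussianReal 0 1) := by
  refine ⟨by fun_prop, ?_⟩
  have h := IsGaussian.map_eq_gaussianReal (μ := stdGaussian E) (innerSL ℝ e)
  rw [integral_strongDual_stdGaussian, variance_dual_stdGaussian, innerSL_apply_norm, he] at h
  simpa using h

/-- The width of `T` in a unit direction is controlled by its Gaussian mean width. -/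
lemma sqrt_two_div_pi_mul_supportWidth_le (hT : ∀ x ∈ T, ‖x‖ ≤ 1) (hne : T.Nonempty) {e : E}
    (he : ‖e‖ = 1) :
    Real.sqrt (2 / Real.pi) * supportWidth T e ≤ ∫ g, supportWidth T g ∂stdGaussian E := by
  have hi := integrable_supportWidth hT hne
  have hr := measurePreserving_axisReflection e
  have hm := map_inner_stdGaussian he
  have hir : Integrable (fun a => supportWidth T (axisReflection e a)) (stdGaussian E) :=
    hr.integrable_comp_of_integrable hi
  have key (a : E) : |⟪e, a⟫| * supportWidth T e ≤
      (1 / 2) * (supportWidth T a + supportWidth T (axisReflection e a)) := by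
    have h := supportWidth_smul hT hne (2 * ⟪e, a⟫) e
    rw [abs_mul, abs_two] at h
    have h2 := supportWidth_add_le hT hne a (axisReflection e a)
    rw [show a + axisReflection e a = (2 * ⟪e, a⟫) • e by
      rw [axisReflection_apply he]; module, h] at h2
    linarith
  have habs : Integrable (fun a : E => |⟪e, a⟫|) (stdGaussian E) :=
    hm.integrable_comp_of_integrable (g := fun x : ℝ => |x|) integrable_id_gaussianReal_zero_one.abs
  have hE : ∫ a, |⟪e, a⟫| ∂stdGaussian E = Real.sqrt (2 / Real.pi) := by
    rw [← integral_abs_gaussianReal, ← hm.map_eq, integral_map hm.aemeasurable (by fun_prop)]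
  have hint := integral_mono (habs.mul_const _) ((hi.add hir).const_mul (1 / 2)) key
  rw [integral_mul_const, hE, integral_const_mul, integral_add' hi hir,
    hr.integral_comp (axisReflection e).toHomeomorph.measurableEmbedding] at hint
  linarith

end SupportWidth

section ProductGaussian

/-- Mean deviation of an empirical mean from the expectation. -/
lemma integral_abs_empirical_sub_le {Ω : Type*} [MeasurableSpace Ω] {μ : Measure Ω}
    [IsProbabilityMeasure μ] {φ : Ω → ℝ} (hφ : MemLp φ 2 μ) {v : ℝ} (hv : 0 < v)
    (hvar : Var[φ; μ] ≤ v) {m : ℕ} (hm : 0 < m) :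
    Integrable (fun A : Fin m → Ω => (m : ℝ)⁻¹ * ∑ i, φ (A i) - ∫ a, φ a ∂μ)
      (Measure.pi fun _ => μ) ∧
    ∫ A : Fin m → Ω, |(m : ℝ)⁻¹ * ∑ i, φ (A i) - ∫ a, φ a ∂μ| ∂(Measure.pi fun _ => μ) ≤
      Real.sqrt (v / m) := by
  have hm' : (0 : ℝ) < m := by exact_mod_cast hm
  set P : Measure (Fin m → Ω) := Measure.pi fun _ => μ
  have hmp (i : Fin m) : MeasurePreserving (fun A : Fin m → Ω => A i) P μ :=
    measurePreserving_eval _ i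
  have hmem (i : Fin m) : MemLp (fun A : Fin m → Ω => φ (A i)) 2 P :=
    hφ.comp_measurePreserving (hmp i)
  have hsum : MemLp (∑ i, fun A : Fin m → Ω => φ (A i)) 2 P :=
    memLp_finsetSum' _ fun i _ => hmem i
  have hint (i : Fin m) : ∫ A, φ (A i) ∂P = ∫ a, φ a ∂μ := by
    rw [← (hmp i).map_eq, integral_map (hmp i).aemeasurable]
    rw [(hmp i).map_eq]; exact hφ.1
  have hmean : ∫ A, (∑ i, fun A : Fin m → Ω => φ (A i)) A ∂P = m * ∫ a, φ a ∂μ := by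
    simp only [Finset.sum_apply]
    rw [integral_finsetSum _ fun i _ => (hmem i).integrable one_le_two]
    simp [hint]
  have hvarsum : Var[∑ i, fun A : Fin m → Ω => φ (A i); P] ≤ m * v := by
    rw [variance_sum_pi (μ := fun _ : Fin m => μ) fun _ => hφ]
    simpa using mul_le_mul_of_nonneg_left hvar hm'.le
  have hX : MemLp (fun A : Fin m → Ω => (m : ℝ)⁻¹ * ∑ i, φ (A i) - ∫ a, φ a ∂μ) 2 P := by
    have := (hsum.const_mul (m : ℝ)⁻¹).sub (memLp_const (∫ a, φ a ∂μ))
    simpa only [Pi.sub_def, Finset.sum_apply] using this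
  refine ⟨hX.integrable one_le_two, ?_⟩
  have hsq : ∫ A : Fin m → Ω, ((m : ℝ)⁻¹ * ∑ i, φ (A i) - ∫ a, φ a ∂μ) ^ 2 ∂P ≤ v / m := by
    rw [variance_eq_integral hsum.1.aemeasurable, hmean] at hvarsum
    have h : ∀ A : Fin m → Ω, ((m : ℝ)⁻¹ * ∑ i, φ (A i) - ∫ a, φ a ∂μ) ^ 2 =
        (m : ℝ)⁻¹ ^ 2 * ((∑ i, fun A : Fin m → Ω => φ (A i)) A - m * ∫ a, φ a ∂μ) ^ 2 := by
      intro A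
      rw [Finset.sum_apply, ← mul_pow]
      field_simp
    simp_rw [h]
    rw [integral_const_mul]
    calc _ ≤ (m : ℝ)⁻¹ ^ 2 * (m * v) := by gcongr
      _ = v / m := by field_simp
  set s := Real.sqrt (v / m) with hs
  have hs0 : 0 < s := Real.sqrt_pos.2 (by positivity)
  have hs2 : s ^ 2 = v / m := Real.sq_sqrt (by positivity)
  have hyoung : ∀ A : Fin m → Ω, |(m : ℝ)⁻¹ * ∑ i, φ (A i) - ∫ a, φ a ∂μ| ≤
      (2 * s)⁻¹ * ((m : ℝ)⁻¹ * ∑ i, φ (A i) - ∫ a, φ a ∂μ) ^ 2 + s / 2 := by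
    intro A
    set X := (m : ℝ)⁻¹ * ∑ i, φ (A i) - ∫ a, φ a ∂μ
    have h : (2 * s)⁻¹ * X ^ 2 + s / 2 - |X| = (2 * s)⁻¹ * (|X| - s) ^ 2 := by
      rw [← sq_abs X]
      field_simp
      ring
    have : 0 ≤ (2 * s)⁻¹ * (|X| - s) ^ 2 := by positivity
    linarith
  refine (integral_mono (hX.integrable one_le_two).abs
    ((hX.integrable_sq.const_mul _).add (integrable_const _)) hyoung).trans ?_
  rw [integral_add' (hX.integrable_sq.const_mul _) (integrable_const _), integral_const_mul]
  simp only [integral_const, probReal_univ, one_smul]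
  calc _ ≤ (2 * s)⁻¹ * s ^ 2 + s / 2 := by rw [hs2]; gcongr
    _ = s := by field_simp; ring

variable {E : Type*} [NormedAddCommGroup E] [InnerProductSpace ℝ E] [FiniteDimensional ℝ E]
  [MeasurableSpace E] [BorelSpace E]

open scoped RealInnerProductSpace

lemma map_toLp_pi_stdGaussian {ι : Type*} [Fintype ι] :
    (Measure.pi fun _ : ι => stdGaussian E).map (WithLp.toLp 2) =
      stdGaussian (PiLp 2 fun _ : ι => E) := by
  apply Measure.ext_of_charFun (E := PiLp 2 fun _ : ι => E)
  ext t
  rw [charFun_pi]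
  simp_rw [charFun_stdGaussian, ← Complex.exp_sum, ← Complex.ofReal_pow,
    PiLp.norm_sq_eq_of_L2]
  simp [Finset.sum_div, neg_div]

lemma measurePreserving_normalized_sum {m : ℕ} (hm : 0 < m) :
    MeasurePreserving (fun A : Fin m → E => (Real.sqrt m)⁻¹ • ∑ i, A i)
      (Measure.pi fun _ => stdGaussian E) (stdGaussian E) := by
  refine ⟨by fun_prop, Measure.ext_of_charFun ?_⟩
  ext t
  have hm' : (0 : ℝ) < m := by exact_mod_cast hm
  have h : (fun A : Fin m → E => (Real.sqrt m)⁻¹ • ∑ i, A i) =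
      (fun x : E => (Real.sqrt m)⁻¹ • x) ∘ fun A : Fin m → E => ∑ i, A i := rfl
  rw [h, ← Measure.map_map (by fun_prop) (by fun_prop), charFun_map_smul,
    charFun_map_sum_pi_eq_prod]
  simp only [Finset.prod_const, Finset.card_univ, Fintype.card_fin, Pi.pow_apply,
    charFun_stdGaussian, ← Complex.exp_nat_mul, norm_smul]
  congr 1
  norm_cast
  rw [mul_pow, norm_inv, inv_pow, Real.norm_eq_abs, sq_abs, Real.sq_sqrt hm'.le]
  field_simp

/-- Concentration for Lipschitz functions of independent standard Gaussian vectors. -/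
lemma pi_stdGaussian_measure_ge_le {ι : Type*} [Fintype ι] {L : ℝ} (hL : 0 < L)
    {F : (ι → E) → ℝ}
    (hF : ∀ A B, |F A - F B| ≤ L * Real.sqrt (∑ i, ‖A i - B i‖ ^ 2)) {t : ℝ} (ht : 0 ≤ t) :
    (Measure.pi fun _ : ι => stdGaussian E).real
      {A | ∫ B, F B ∂(Measure.pi fun _ : ι => stdGaussian E) + t ≤ F A} ≤
        Real.exp (-t ^ 2 / (2 * L ^ 2)) := by
  have h := stdGaussian_measure_ge_le (E := PiLp 2 fun _ : ι => E) hL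
    (F := fun x => F (WithLp.ofLp x)) (fun x y => by
      rw [PiLp.norm_eq_of_L2]; exact hF _ _) ht
  rw [← map_toLp_pi_stdGaussian, ← MeasurableEquiv.coe_toLp, integral_map_equiv, Measure.real,
    MeasurableEquiv.map_apply] at h
  exact h

lemma integrable_of_lipschitz_pi {ι : Type*} [Fintype ι] {L : ℝ} {F : (ι → E) → ℝ}
    (hF : ∀ A B, |F A - F B| ≤ L * Real.sqrt (∑ i, ‖A i - B i‖ ^ 2)) :
    Integrable F (Measure.pi fun _ : ι => stdGaussian E) := by
  have h := integrable_comp_add_smul (E := PiLp 2 fun _ : ι => E)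
    (F := fun x => F (WithLp.ofLp x)) (fun x y => by
      rw [PiLp.norm_eq_of_L2]; exact hF _ _) 0 1
  rw [← map_toLp_pi_stdGaussian, ← MeasurableEquiv.coe_toLp, integrable_map_equiv] at h
  simpa [Function.comp_def] using h

end ProductGaussian

section FoldedDeviation

variable {E : Type*} [NormedAddCommGroup E] [InnerProductSpace ℝ E] [FiniteDimensional ℝ E]
  [MeasurableSpace E] [BorelSpace E] {T : Set E} {e : E} {m : ℕ}

open scoped RealInnerProductSpace

lemma integral_halfspaceFold (he : ‖e‖ = 1) :
    ∫ a, halfspaceFold e a ∂stdGaussian E = (∫ x, (|x| - x) ∂gaussianReal 0 1) • e := by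
  have hm := map_inner_stdGaussian he
  have hint : Integrable (fun a : E => |⟪e, a⟫| - ⟪e, a⟫) (stdGaussian E) :=
    hm.integrable_comp_of_integrable (g := fun x : ℝ => |x| - x)
      (integrable_id_gaussianReal_zero_one.abs.sub integrable_id_gaussianReal_zero_one)
  have hid : Integrable (fun a : E => a) (stdGaussian E) := IsGaussian.integrable_id
  unfold halfspaceFold
  rw [integral_add hid (hint.smul_const e), integral_id_stdGaussian,
    zero_add, integral_smul_const, ← hm.map_eq, integral_map hm.aemeasurable (by fun_prop)]

/-- The width of `T` along the deviation of the empirical mean of the folded Gaussian vectors. -/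
def foldedDeviation (T : Set E) (e : E) (A : Fin m → E) : ℝ :=
  supportWidth T ((m : ℝ)⁻¹ • ∑ i, halfspaceFold e (A i) - ∫ a, halfspaceFold e a ∂stdGaussian E)

omit [BorelSpace E] in
lemma abs_foldedDeviation_sub_le (hT : ∀ x ∈ T, ‖x‖ ≤ 1) (hne : T.Nonempty) (he : ‖e‖ = 1)
    (hm : 0 < m) (A B : Fin m → E) :
    |foldedDeviation T e A - foldedDeviation T e B| ≤
      2 / Real.sqrt m * Real.sqrt (∑ i, ‖A i - B i‖ ^ 2) := by
  have hm' : (0 : ℝ) < m := by exact_mod_cast hm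
  refine (abs_supportWidth_sub_le hT hne _ _).trans ?_
  rw [sub_sub_sub_cancel_right, ← smul_sub, ← Finset.sum_sub_distrib, norm_smul, norm_inv,
    Real.norm_of_nonneg hm'.le]
  have h1 : ‖∑ i, (halfspaceFold e (A i) - halfspaceFold e (B i))‖ ≤ ∑ i, ‖A i - B i‖ :=
    norm_sum_le_of_le _ fun i _ => norm_halfspaceFold_sub_le he _ _
  have h2 : ∑ i, ‖A i - B i‖ ≤ Real.sqrt m * Real.sqrt (∑ i, ‖A i - B i‖ ^ 2) := by
    rw [← Real.sqrt_mul hm'.le]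
    refine Real.le_sqrt_of_sq_le ?_
    simpa using sq_sum_le_card_mul_sum_sq (s := Finset.univ) (f := fun i => ‖A i - B i‖)
  have hs : Real.sqrt m * Real.sqrt m = m := Real.mul_self_sqrt hm'.le
  have hs0 : 0 < Real.sqrt m := Real.sqrt_pos.2 hm'
  calc _ ≤ 2 * ((m : ℝ)⁻¹ * (Real.sqrt m * Real.sqrt (∑ i, ‖A i - B i‖ ^ 2))) := by
        gcongr; exact h1.trans h2
    _ = _ := by
      nth_rewrite 1 [← hs]
      field_simp

lemma integral_foldedDeviation_le (hT : ∀ x ∈ T, ‖x‖ ≤ 1) (hne : T.Nonempty) (he : ‖e‖ = 1)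
    (hm : 0 < m) :
    ∫ A : Fin m → E, foldedDeviation T e A ∂(Measure.pi fun _ => stdGaussian E) ≤
      4 * (∫ g, supportWidth T g ∂stdGaussian E) / Real.sqrt m := by
  have hm' : (0 : ℝ) < m := by exact_mod_cast hm
  have hs : Real.sqrt m * Real.sqrt m = m := Real.mul_self_sqrt hm'.le
  have hs0 : 0 < Real.sqrt m := Real.sqrt_pos.2 hm'
  set W := ∫ g, supportWidth T g ∂stdGaussian E with hW
  set P : Measure (Fin m → E) := Measure.pi fun _ => stdGaussian E
  have hin := map_inner_stdGaussian he
  have hmean : ∫ a : E, (|⟪e, a⟫| - ⟪e, a⟫) ∂stdGaussian E = ∫ x, (|x| - x) ∂gaussianReal 0 1 := by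
    rw [← hin.map_eq, integral_map hin.aemeasurable (by fun_prop)]
  have hmem1 : MemLp (fun x : ℝ => |x| - x) 2 (gaussianReal 0 1) :=
    (memLp_id_gaussianReal 2).abs.sub (memLp_id_gaussianReal 2)
  have hmem : MemLp (fun a : E => |⟪e, a⟫| - ⟪e, a⟫) 2 (stdGaussian E) :=
    hmem1.comp_measurePreserving hin
  have hvar : Var[fun a : E => |⟪e, a⟫| - ⟪e, a⟫; stdGaussian E] ≤ 2 := by
    have h := variance_map (X := fun x : ℝ => |x| - x) (Y := fun a : E => ⟪e, a⟫)
      (μ := stdGaussian E) (by fun_prop) hin.aemeasurable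
    rw [hin.map_eq] at h
    exact h.symm.trans_le variance_abs_sub_gaussianReal_le
  obtain ⟨hκi, hκ⟩ := integral_abs_empirical_sub_le hmem two_pos hvar hm
  have hsum := measurePreserving_normalized_sum (E := E) hm
  have hpt (A : Fin m → E) : foldedDeviation T e A ≤
      (Real.sqrt m)⁻¹ * supportWidth T ((Real.sqrt m)⁻¹ • ∑ i, A i) +
      |(m : ℝ)⁻¹ * ∑ i, (|⟪e, A i⟫| - ⟪e, A i⟫) - ∫ a : E, (|⟪e, a⟫| - ⟪e, a⟫) ∂stdGaussian E| *
        supportWidth T e := by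
    have h1 := supportWidth_smul hT hne (Real.sqrt m)⁻¹ ((Real.sqrt m)⁻¹ • ∑ i, A i)
    rw [abs_of_pos (inv_pos.2 hs0)] at h1
    rw [← h1, ← supportWidth_smul hT hne, smul_smul, ← mul_inv, hs]
    refine le_of_eq_of_le ?_ (supportWidth_add_le hT hne _ _)
    rw [foldedDeviation, integral_halfspaceFold he, hmean]
    congr 1
    simp only [halfspaceFold, Finset.sum_add_distrib, ← Finset.sum_smul]
    module
  have hi1 : Integrable (fun A : Fin m → E => supportWidth T ((Real.sqrt m)⁻¹ • ∑ i, A i)) P :=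
    hsum.integrable_comp_of_integrable (integrable_supportWidth hT hne)
  have hint1 : ∫ A : Fin m → E, supportWidth T ((Real.sqrt m)⁻¹ • ∑ i, A i) ∂P = W := by
    rw [hW, ← hsum.map_eq, integral_map hsum.aemeasurable]
    exact (continuous_of_abs_sub_le (abs_supportWidth_sub_le hT hne)).aestronglyMeasurable
  have hle := integral_mono (integrable_of_lipschitz_pi (abs_foldedDeviation_sub_le hT hne he hm))
    ((hi1.const_mul _).add (hκi.abs.mul_const _)) hpt
  rw [integral_add' (hi1.const_mul _) (hκi.abs.mul_const _), integral_const_mul,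
    integral_mul_const, hint1] at hle
  have hSe := supportWidth_nonneg hT hne e
  have hWe := sqrt_two_div_pi_mul_supportWidth_le hT hne he
  rw [← hW] at hWe
  have hW0 : 0 ≤ W := integral_nonneg fun g => supportWidth_nonneg hT hne g
  have hpi : Real.sqrt 2 ≤ 3 * Real.sqrt (2 / Real.pi) := by
    rw [show (3 : ℝ) = Real.sqrt 9 by rw [show (9 : ℝ) = 3 ^ 2 by norm_num]; simp,
      ← Real.sqrt_mul (by norm_num)]
    apply Real.sqrt_le_sqrt
    rw [mul_div_assoc', le_div_iff₀ Real.pi_pos]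
    linarith [Real.pi_lt_four]
  calc _ ≤ _ := hle
    _ ≤ (Real.sqrt m)⁻¹ * W + Real.sqrt (2 / m) * supportWidth T e := by gcongr
    _ = (W + Real.sqrt 2 * supportWidth T e) / Real.sqrt m := by
      rw [Real.sqrt_div zero_le_two]; field_simp
    _ ≤ (W + 3 * W) / Real.sqrt m := by
      refine div_le_div_of_nonneg_right ?_ hs0.le
      nlinarith
    _ = _ := by ring

omit [FiniteDimensional ℝ E] in
lemma measurable_sgn_inner_smul [SecondCountableTopology E] (e : E) :
    Measurable fun a : E => sgn ⟪e, a⟫ • a := by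
  have : Measurable sgn :=
    Measurable.ite (measurableSet_lt measurable_const measurable_id) measurable_const
      measurable_const
  fun_prop

/-- Concentration of the width of `T` along the deviation of the signed empirical mean. -/
theorem signedDeviation_measure_ge_le (hT : ∀ x ∈ T, ‖x‖ ≤ 1) (hne : T.Nonempty) (he : ‖e‖ = 1)
    (hm : 0 < m) {t : ℝ} (ht : 0 ≤ t) :
    (Measure.pi fun _ : Fin m => stdGaussian E).real
      {A | 4 * (∫ g, supportWidth T g ∂stdGaussian E) / Real.sqrt m + t ≤
        supportWidth T ((m : ℝ)⁻¹ • ∑ i, sgn ⟪e, A i⟫ • A i -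
          ∫ a, sgn ⟪e, a⟫ • a ∂stdGaussian E)} ≤ Real.exp (-(m * t ^ 2 / 8)) := by
  have hm' : (0 : ℝ) < m := by exact_mod_cast hm
  have hs0 : 0 < Real.sqrt m := Real.sqrt_pos.2 hm'
  have htw := measurePreserving_halfspaceTwist he
  have hsm := measurable_sgn_inner_smul e
  have hmean : ∫ a, sgn ⟪e, a⟫ • a ∂stdGaussian E = ∫ a, halfspaceFold e a ∂stdGaussian E := by
    conv_lhs => rw [← htw.map_eq]
    rw [integral_map htw.aemeasurable hsm.aestronglyMeasurable]
    simp_rw [sgn_smul_halfspaceTwist he]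
  have hpi := measurePreserving_pi (fun _ : Fin m => stdGaussian E) (fun _ => stdGaussian E)
    fun _ => htw
  have hmeas : MeasurableSet {A : Fin m → E |
      4 * (∫ g, supportWidth T g ∂stdGaussian E) / Real.sqrt m + t ≤
        supportWidth T ((m : ℝ)⁻¹ • ∑ i, sgn ⟪e, A i⟫ • A i -
          ∫ a, sgn ⟪e, a⟫ • a ∂stdGaussian E)} := by
    refine measurableSet_le measurable_const
      ((continuous_of_abs_sub_le (abs_supportWidth_sub_le hT hne)).measurable.comp ?_)
    refine Measurable.sub_const (Measurable.const_smul ?_ _) _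
    exact Finset.measurable_fun_sum _ fun i _ => hsm.comp (measurable_pi_apply i)
  rw [← hpi.measureReal_preimage hmeas.nullMeasurableSet]
  have hL : (0 : ℝ) < 2 / Real.sqrt m := by positivity
  refine (measureReal_mono fun A hA => ?_).trans
    ((pi_stdGaussian_measure_ge_le hL (abs_foldedDeviation_sub_le hT hne he hm) ht).trans_eq ?_)
  · simp only [Set.mem_preimage, Set.mem_ofPred_eq, sgn_smul_halfspaceTwist he, hmean] at hA ⊢
    exact (add_le_add_left (integral_foldedDeviation_le hT hne he hm) t).trans hA
  · rw [div_pow, Real.sq_sqrt hm'.le]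
    congr 1
    field_simp
    norm_num

end FoldedDeviation

section Coordinates

open scoped RealInnerProductSpace

variable {n m : ℕ}

lemma inner_toLp_eq_evInner (u v : Fin n → ℝ) :
    ⟪WithLp.toLp 2 u, WithLp.toLp 2 v⟫ = evInner u v := by
  simp [evInner, PiLp.inner_apply, mul_comm]

lemma norm_toLp_eq_evNorm (u : Fin n → ℝ) : ‖WithLp.toLp 2 u‖ = evNorm u := by
  simp [evNorm, EuclideanSpace.norm_eq]

lemma measurePreserving_toLp_stdGaussianVec :
    MeasurePreserving (MeasurableEquiv.toLp 2 (Fin n → ℝ)) (stdGaussianVec n)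
      (stdGaussian (EuclideanSpace ℝ (Fin n))) :=
  ⟨(MeasurableEquiv.toLp 2 (Fin n → ℝ)).measurable, map_pi_eq_stdGaussian⟩

instance : IsProbabilityMeasure (stdGaussianVec n) := by
  unfold stdGaussianVec; infer_instance

instance : IsProbabilityMeasure (stdGaussianMatrix m n) := by
  unfold stdGaussianMatrix; infer_instance

lemma measurePreserving_toLp_stdGaussianMatrix :
    MeasurePreserving (fun (A : Fin m → Fin n → ℝ) i => (WithLp.toLp 2 (A i) :
      EuclideanSpace ℝ (Fin n))) (stdGaussianMatrix m n)
      (Measure.pi fun _ => stdGaussian (EuclideanSpace ℝ (Fin n))) :=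
  measurePreserving_pi _ _ fun _ => measurePreserving_toLp_stdGaussianVec

lemma supportWidth_image_toLp (T : Set (Fin n → ℝ)) (w : Fin n → ℝ) :
    supportWidth (WithLp.toLp 2 '' T) (WithLp.toLp 2 w) =
      sSup {t : ℝ | ∃ x ∈ T, ∃ x' ∈ T, t = evInner w (x - x')} := by
  simp only [supportWidth, Set.exists_mem_image, ← WithLp.toLp_sub, inner_toLp_eq_evInner]

lemma meanWidth_eq_integral_supportWidth (T : Set (Fin n → ℝ)) :
    meanWidth T = ∫ g, supportWidth (WithLp.toLp 2 '' T) g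
      ∂stdGaussian (EuclideanSpace ℝ (Fin n)) := by
  rw [← measurePreserving_toLp_stdGaussianVec.map_eq, integral_map_equiv, meanWidth]
  simp only [MeasurableEquiv.coe_toLp, supportWidth_image_toLp]

lemma corrFun_eq_inner (xstar : Fin n → ℝ) (A : Fin m → Fin n → ℝ) (u : Fin n → ℝ) :
    corrFun xstar A u = ⟪(m : ℝ)⁻¹ • ∑ i, sgn ⟪WithLp.toLp 2 xstar, WithLp.toLp 2 (A i)⟫ •
      (WithLp.toLp 2 (A i) : EuclideanSpace ℝ (Fin n)), WithLp.toLp 2 u⟫ := by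
  simp_rw [corrFun, one_div, real_inner_smul_left, sum_inner, real_inner_smul_left,
    inner_toLp_eq_evInner, ← inner_toLp_eq_evInner (A _) xstar, ← inner_toLp_eq_evInner xstar,
    real_inner_comm (WithLp.toLp 2 xstar)]

lemma integral_corrFun (hm : 0 < m) (xstar : Fin n → ℝ) (u : Fin n → ℝ) :
    ∫ A, corrFun xstar A u ∂stdGaussianMatrix m n =
      ⟪∫ a, sgn ⟪WithLp.toLp 2 xstar, a⟫ • a ∂stdGaussian (EuclideanSpace ℝ (Fin n)),
        WithLp.toLp 2 u⟫ := by
  have hm' : (m : ℝ) ≠ 0 := by exact_mod_cast hm.ne'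
  set e : EuclideanSpace ℝ (Fin n) := WithLp.toLp 2 xstar
  set γ := stdGaussian (EuclideanSpace ℝ (Fin n))
  have hY : Integrable (fun a => sgn ⟪e, a⟫ • a) γ := by
    refine Integrable.mono' integrable_norm_stdGaussian
      (measurable_sgn_inner_smul e).aestronglyMeasurable (ae_of_all _ fun a => ?_)
    rw [norm_smul, sgn]
    split_ifs <;> simp
  have hev (i : Fin m) : MeasurePreserving
      (fun A : Fin m → EuclideanSpace ℝ (Fin n) => A i) (Measure.pi fun _ => γ) γ :=
    measurePreserving_eval _ i
  have hYi (i : Fin m) : Integrable (fun A : Fin m → EuclideanSpace ℝ (Fin n) =>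
      ⟪sgn ⟪e, A i⟫ • A i, WithLp.toLp 2 u⟫) (Measure.pi fun _ => γ) :=
    (hev i).integrable_comp_of_integrable (hY.inner_const _)
  have hmeas : Measurable fun a => ⟪sgn ⟪e, a⟫ • a, WithLp.toLp 2 u⟫ :=
    (measurable_sgn_inner_smul e).inner measurable_const
  have hi (i : Fin m) : ∫ A : Fin m → EuclideanSpace ℝ (Fin n),
      ⟪sgn ⟪e, A i⟫ • A i, WithLp.toLp 2 u⟫ ∂(Measure.pi fun _ => γ) =
        ⟪∫ a, sgn ⟪e, a⟫ • a ∂γ, WithLp.toLp 2 u⟫ := by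
    rw [real_inner_comm, ← integral_inner hY]
    simp_rw [real_inner_comm _ (WithLp.toLp 2 u)]
    conv_rhs => rw [← (hev i).map_eq]
    rw [integral_map (hev i).aemeasurable hmeas.aestronglyMeasurable]
  simp_rw [corrFun_eq_inner, real_inner_smul_left, sum_inner]
  rw [integral_const_mul]
  have h := integral_finsetSum Finset.univ fun i _ => hYi i
  simp only [hi, Finset.sum_const, Finset.card_univ, Fintype.card_fin, nsmul_eq_mul] at h
  rw [← measurePreserving_toLp_stdGaussianMatrix.map_eq,
    integral_map measurePreserving_toLp_stdGaussianMatrix.aemeasurable] at h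
  · rw [h, inv_mul_cancel_left₀ hm']
  · exact (Finset.measurable_fun_sum _ fun i _ =>
      hmeas.comp (measurable_pi_apply i)).aestronglyMeasurable

end Coordinates

/-- Lemma 2 (Plan–Vershynin concentration via Gaussian mean width). -/
theorem corrFun_concentration (n m : ℕ) (xstar : Fin n → ℝ) (hxstar : evNorm xstar = 1)
    (T : Set (Fin n → ℝ)) (hT : ∀ x ∈ T, evNorm x ≤ 1) (t : ℝ) (ht : 0 < t) :
    stdGaussianMatrix m n
        {A | 4 * meanWidth T / Real.sqrt (m : ℝ) + t ≤
          sSup {v : ℝ | ∃ x ∈ T, ∃ x' ∈ T,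
            v = |corrFun xstar A (x - x') -
              ∫ A', corrFun xstar A' (x - x') ∂ stdGaussianMatrix m n|}} ≤
      ENNReal.ofReal (4 * Real.exp (-((m : ℝ) * t ^ 2 / 8))) := by
  rcases m.eq_zero_or_pos with rfl | hm
  · refine prob_le_one.trans ?_
    simp
  rcases T.eq_empty_or_nonempty with rfl | hne
  · simp [meanWidth, ht.not_ge]
  have he : ‖(WithLp.toLp 2 xstar : EuclideanSpace ℝ (Fin n))‖ = 1 := by
    rw [norm_toLp_eq_evNorm, hxstar]
  have hT' : ∀ x ∈ (WithLp.toLp 2 '' T : Set (EuclideanSpace ℝ (Fin n))), ‖x‖ ≤ 1 := by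
    rintro _ ⟨x, hx, rfl⟩
    rw [norm_toLp_eq_evNorm]
    exact hT x hx
  have h := signedDeviation_measure_ge_le hT' (hne.image _) he hm ht.le
  have hmp := measurePreserving_toLp_stdGaussianMatrix (m := m) (n := n)
  rw [← ENNReal.ofReal_le_ofReal_iff (Real.exp_pos _).le, ofReal_measureReal] at h
  refine (measure_mono fun A hA => ?_).trans
    ((hmp.measure_preimage_le _).trans (h.trans (ENNReal.ofReal_le_ofReal ?_)))
  · rw [Set.mem_ofPred_eq, meanWidth_eq_integral_supportWidth] at hA
    refine hA.trans ?_
    obtain ⟨x₀, hx₀⟩ := hne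
    refine csSup_le ⟨_, x₀, hx₀, x₀, hx₀, rfl⟩ ?_
    rintro _ ⟨x, hx, x', hx', rfl⟩
    rw [corrFun_eq_inner, integral_corrFun hm, ← inner_sub_left, WithLp.toLp_sub]
    exact abs_inner_le_supportWidth hT' _ (Set.mem_image_of_mem _ hx) (Set.mem_image_of_mem _ hx')
  · linarith [Real.exp_pos (-((m : ℝ) * t ^ 2 / 8))]
end
end

section
/- There exists a universal constant C' > 0 with the following property. Let G : ℝ^s → ℝ^n be a d-layer feedforward neural network with at most N nodes per layer, all weights bounded by w_max in absolute value, and L-Lipschitz activations, with L·N·w_max ≥ 2 and r ≥ 1. Let S = {G(z) : z ∈ ℝ^s, ‖z‖ ≤ r, ‖G(z)‖ ≤ 1}. Then the Gaussian mean width of S satisfies W(S) ≤ 8 r √s + C' √( s d log(L N w_max) ). -/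
open MeasureTheory ProbabilityTheory

noncomputable section

/-- `φ : ℝ^p → ℝ^q` is a neural-network layer with at most `N` nodes, all weights bounded
by `wmax` in absolute value, and an `L`-Lipschitz activation map:
`φ(v) = σ(W v + b)`. -/
def IsLayer (L wmax : ℝ) (N : ℕ) {p q : ℕ} (φ : (Fin p → ℝ) → (Fin q → ℝ)) : Prop :=
  p ≤ N ∧ q ≤ N ∧
    ∃ (W : Fin q → Fin p → ℝ) (b : Fin q → ℝ) (σ : (Fin q → ℝ) → (Fin q → ℝ)),
      (∀ j k, |W j k| ≤ wmax) ∧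
      (∀ v v', evNorm (σ v - σ v') ≤ L * evNorm (v - v')) ∧
      (∀ v, φ v = σ (fun j => (∑ k, W j k * v k) + b j))

/-- `IsMLP L wmax N d s n G` : `G : ℝ^s → ℝ^n` is a `d`-layer feedforward neural network with
at most `N` nodes per layer, all weights bounded by `wmax` in absolute value, and
`L`-Lipschitz activations. -/
inductive IsMLP (L wmax : ℝ) (N : ℕ) : ∀ (d s n : ℕ), ((Fin s → ℝ) → (Fin n → ℝ)) → Prop
  | single {s n : ℕ} {φ : (Fin s → ℝ) → (Fin n → ℝ)} (h : IsLayer L wmax N φ) :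
      IsMLP L wmax N 1 s n φ
  | comp {d s p n : ℕ} {G : (Fin s → ℝ) → (Fin p → ℝ)} {φ : (Fin p → ℝ) → (Fin n → ℝ)}
      (hG : IsMLP L wmax N d s p G) (hφ : IsLayer L wmax N φ) :
      IsMLP L wmax N (d + 1) s n (fun z => φ (G z))

open Function in
/-- A volume bound for the cardinality of separated sets in a ball. -/
theorem card_le_of_separated_of_norm_le {E : Type*} [NormedAddCommGroup E] [NormedSpace ℝ E]
    [FiniteDimensional ℝ E] {r δ : ℝ} (hr : 0 ≤ r) (hδ : 0 < δ) (t : Finset E)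
    (ht : ∀ c ∈ t, ‖c‖ ≤ r) (h : ∀ c ∈ t, ∀ d ∈ t, c ≠ d → δ ≤ ‖c - d‖) :
    (t.card : ℝ) ≤ ((2 * r + δ) / δ) ^ Module.finrank ℝ E := by
  borelize E
  let μ : Measure E := Measure.addHaar
  have hδ2 : 0 < δ / 2 := by positivity
  have hρ : 0 < r + δ / 2 := by positivity
  have hdisj : Set.Pairwise (t : Set E) (Disjoint on fun c => Metric.ball (c : E) (δ / 2)) := by
    rintro c hc d hd hcd
    apply Metric.ball_disjoint_ball
    rw [dist_eq_norm, add_halves]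
    exact h c hc d hd hcd
  have hsub : (⋃ c ∈ t, Metric.ball (c : E) (δ / 2)) ⊆ Metric.ball (0 : E) (r + δ / 2) := by
    refine Set.iUnion₂_subset fun x hx => Metric.ball_subset_ball' ?_
    rw [dist_zero_right]
    linarith [ht x hx]
  have hvol :
      (t.card : ENNReal) * ENNReal.ofReal ((δ / 2) ^ Module.finrank ℝ E) * μ (Metric.ball 0 1) ≤
        ENNReal.ofReal ((r + δ / 2) ^ Module.finrank ℝ E) * μ (Metric.ball 0 1) :=
    calc
      _ = μ (⋃ c ∈ t, Metric.ball (c : E) (δ / 2)) := by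
        rw [measure_biUnion_finset hdisj fun c _ => measurableSet_ball]
        simp only [μ.addHaar_ball_of_pos _ hδ2, Finset.sum_const, nsmul_eq_mul, mul_assoc]
      _ ≤ μ (Metric.ball (0 : E) (r + δ / 2)) := measure_mono hsub
      _ = _ := by simp only [μ.addHaar_ball_of_pos _ hρ]
  have hcard := (ENNReal.mul_le_mul_iff_left
    (Metric.measure_ball_pos μ _ zero_lt_one).ne' measure_ball_lt_top.ne).1 hvol
  have hreal := ENNReal.toReal_le_of_le_ofReal (pow_nonneg hρ.le _) hcard
  rw [ENNReal.toReal_mul, ENNReal.toReal_natCast,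
    ENNReal.toReal_ofReal (pow_nonneg hδ2.le _), ← le_div_iff₀ (by positivity), ← div_pow] at hreal
  have hratio : (2 * r + δ) / δ = (r + δ / 2) / (δ / 2) := by field_simp
  rwa [hratio]

/-- Every ball has a finite `δ`-net of the size predicted by volume comparison. -/
theorem exists_finset_net {E : Type*} [NormedAddCommGroup E] [NormedSpace ℝ E]
    [FiniteDimensional ℝ E] {r δ : ℝ} (hr : 0 ≤ r) (hδ : 0 < δ) :
    ∃ t : Finset E, (t.card : ℝ) ≤ ((2 * r + δ) / δ) ^ Module.finrank ℝ E ∧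
      ∀ x : E, ‖x‖ ≤ r → ∃ c ∈ t, ‖x - c‖ ≤ δ := by
  classical
  let A : Set ℕ := {k | ∃ t : Finset E, t.card = k ∧ (∀ c ∈ t, ‖c‖ ≤ r) ∧
    ∀ c ∈ t, ∀ d ∈ t, c ≠ d → δ ≤ ‖c - d‖}
  have hA : A.Nonempty := ⟨0, ∅, by simp⟩
  have hbdd : BddAbove A := by
    refine ⟨⌊((2 * r + δ) / δ) ^ Module.finrank ℝ E⌋₊, ?_⟩
    rintro _ ⟨t, rfl, ht, hsep⟩
    exact Nat.le_floor (card_le_of_separated_of_norm_le hr hδ t ht hsep)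
  obtain ⟨t, htc, ht, hsep⟩ := Nat.sSup_mem hA hbdd
  refine ⟨t, card_le_of_separated_of_norm_le hr hδ t ht hsep, fun x hx => ?_⟩
  by_contra! hfar
  have hxt : x ∉ t := fun hxt => by simpa using (hδ.trans (hfar x hxt))
  have hmem : (insert x t).card ∈ A := by
    refine ⟨_, rfl, ?_, ?_⟩
    · simpa [hx] using ht
    · intro c hc d hd hcd
      rw [Finset.mem_insert] at hc hd
      rcases hc with rfl | hc <;> rcases hd with rfl | hd
      · exact absurd rfl hcd
      · exact (hfar d hd).le
      · rw [norm_sub_rev]; exact (hfar c hc).le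
      · exact hsep c hc d hd hcd
  have := le_csSup hbdd hmem
  rw [← htc, Finset.card_insert_of_notMem hxt] at this
  omega

theorem evNorm_eq_norm {n : ℕ} (x : Fin n → ℝ) : evNorm x = ‖WithLp.toLp 2 x‖ := by
  simp [evNorm, EuclideanSpace.norm_eq]

theorem evNorm_nonneg {n : ℕ} (x : Fin n → ℝ) : 0 ≤ evNorm x := Real.sqrt_nonneg _

theorem evNorm_sq {n : ℕ} (x : Fin n → ℝ) : evNorm x ^ 2 = ∑ i, x i ^ 2 :=
  Real.sq_sqrt (Finset.sum_nonneg fun _ _ => sq_nonneg _)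

theorem evNorm_add_le {n : ℕ} (x y : Fin n → ℝ) : evNorm (x + y) ≤ evNorm x + evNorm y := by
  simp only [evNorm_eq_norm, WithLp.toLp_add]
  exact norm_add_le _ _

theorem evNorm_neg {n : ℕ} (x : Fin n → ℝ) : evNorm (-x) = evNorm x := by
  simp [evNorm]

theorem evInner_eq_inner {n : ℕ} (u v : Fin n → ℝ) :
    evInner u v = inner ℝ (WithLp.toLp 2 u : EuclideanSpace ℝ (Fin n)) (WithLp.toLp 2 v) := by
  simp [evInner, PiLp.inner_apply, mul_comm]

theorem abs_evInner_le {n : ℕ} (u v : Fin n → ℝ) : |evInner u v| ≤ evNorm u * evNorm v := by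
  rw [evInner_eq_inner, evNorm_eq_norm, evNorm_eq_norm]
  exact abs_real_inner_le_norm _ _

theorem evInner_sub {n : ℕ} (g u v : Fin n → ℝ) :
    evInner g (u - v) = evInner g u - evInner g v := by
  simp [evInner, mul_sub, Finset.sum_sub_distrib]

/-- The image of a ball of `ℝ^s` under an `M`-Lipschitz map has an `ε`-net of size
`(1 + 2 r M / ε) ^ s`. -/
theorem exists_finset_net_image {s n : ℕ} {r M ε : ℝ} (hr : 0 ≤ r) (hM : 0 < M) (hε : 0 < ε)
    {G : (Fin s → ℝ) → (Fin n → ℝ)} (hG : ∀ v v', evNorm (G v - G v') ≤ M * evNorm (v - v')) :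
    ∃ t : Finset (Fin n → ℝ), (t.card : ℝ) ≤ (2 * r * M / ε + 1) ^ s ∧
      ∀ z, evNorm z ≤ r → ∃ c ∈ t, evNorm (G z - c) ≤ ε := by
  classical
  obtain ⟨t, hcard, hnet⟩ :=
    exists_finset_net (E := EuclideanSpace ℝ (Fin s)) hr (div_pos hε hM)
  refine ⟨t.image fun c => G (WithLp.ofLp c), ?_, fun z hz => ?_⟩
  · refine (Nat.cast_le.2 Finset.card_image_le).trans (hcard.trans (le_of_eq ?_))
    rw [finrank_euclideanSpace, Fintype.card_fin]
    congr 1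
    field_simp
  · obtain ⟨c, hc, hzc⟩ := hnet (WithLp.toLp 2 z) (by rwa [← evNorm_eq_norm])
    refine ⟨_, Finset.mem_image_of_mem _ hc, (hG _ _).trans ?_⟩
    rw [evNorm_eq_norm (z - _)]
    calc M * ‖WithLp.toLp 2 (z - WithLp.ofLp c)‖ ≤ M * (ε / M) := by
          gcongr
          simpa [WithLp.toLp_sub] using hzc
      _ = ε := by field_simp

/-- A layer is Lipschitz with constant `L N w_max`. -/
theorem IsLayer.evNorm_sub_le {L wmax : ℝ} {N p q : ℕ} {φ : (Fin p → ℝ) → (Fin q → ℝ)}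
    (h : IsLayer L wmax N φ) (hK : 2 ≤ L * N * wmax) (v v' : Fin p → ℝ) :
    evNorm (φ v - φ v') ≤ L * N * wmax * evNorm (v - v') := by
  obtain ⟨hp, hq, W, b, σ, hW, hσ, hφ⟩ := h
  rcases Nat.eq_zero_or_pos q with rfl | hq0
  · have h0 : evNorm (φ v - φ v') = 0 := by simp [evNorm]
    rw [h0]
    exact mul_nonneg (by linarith) (evNorm_nonneg _)
  have hL : 0 ≤ L := by
    by_contra! hL
    have h1 := (evNorm_nonneg _).trans (hσ (fun _ => 1) 0)
    have h2 : 0 < evNorm ((fun _ => 1 : Fin q → ℝ) - 0) := by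
      simp only [evNorm, sub_zero, one_pow, Finset.sum_const, Finset.card_univ, Fintype.card_fin,
        nsmul_eq_mul, mul_one]
      positivity
    nlinarith
  have hw : 0 ≤ wmax := by
    by_contra! hw
    have : L * N * wmax ≤ 0 := mul_nonpos_of_nonneg_of_nonpos (by positivity) hw.le
    linarith
  rw [hφ, hφ, mul_assoc, mul_assoc]
  refine (hσ _ _).trans (mul_le_mul_of_nonneg_left ?_ hL)
  have hrow : ∀ j, (((fun j => (∑ k, W j k * v k) + b j) - fun j => (∑ k, W j k * v' k) + b j) j) ^ 2
      ≤ N * wmax ^ 2 * evNorm (v - v') ^ 2 := by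
    intro j
    have h1 : ((fun j => (∑ k, W j k * v k) + b j) - fun j => (∑ k, W j k * v' k) + b j) j
        = ∑ k, W j k * (v - v') k := by
      simp [mul_sub, Finset.sum_sub_distrib]
    rw [h1, evNorm_sq]
    refine (Finset.sum_mul_sq_le_sq_mul_sq _ _ _).trans ?_
    refine mul_le_mul_of_nonneg_right ?_ (Finset.sum_nonneg fun _ _ => sq_nonneg _)
    calc ∑ k, W j k ^ 2 ≤ ∑ _k : Fin p, wmax ^ 2 :=
          Finset.sum_le_sum fun k _ => sq_le_sq' (abs_le.1 (hW j k)).1 (abs_le.1 (hW j k)).2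
      _ = p * wmax ^ 2 := by simp
      _ ≤ N * wmax ^ 2 := by gcongr
  have hnn := evNorm_nonneg (v - v')
  refine Real.sqrt_le_iff.2 ⟨by positivity, ?_⟩
  calc _ ≤ ∑ _j : Fin q, N * wmax ^ 2 * evNorm (v - v') ^ 2 := Finset.sum_le_sum fun j _ => hrow j
    _ = q * (N * wmax ^ 2 * evNorm (v - v') ^ 2) := by simp
    _ ≤ N * (N * wmax ^ 2 * evNorm (v - v') ^ 2) := by gcongr
    _ = _ := by ring

theorem IsMLP.evNorm_sub_le {L wmax : ℝ} {N d s n : ℕ} {G : (Fin s → ℝ) → (Fin n → ℝ)}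
    (h : IsMLP L wmax N d s n G) (hK : 2 ≤ L * N * wmax) (v v' : Fin s → ℝ) :
    evNorm (G v - G v') ≤ (L * N * wmax) ^ d * evNorm (v - v') := by
  induction h with
  | single h => simpa using h.evNorm_sub_le hK v v'
  | comp hG hφ ih =>
    refine (hφ.evNorm_sub_le hK _ _).trans ?_
    rw [pow_succ', mul_assoc (L * N * wmax)]
    exact mul_le_mul_of_nonneg_left (ih v v') (zero_le_two.trans hK)

theorem IsMLP.depth_pos {L wmax : ℝ} {N d s n : ℕ} {G : (Fin s → ℝ) → (Fin n → ℝ)}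
    (h : IsMLP L wmax N d s n G) : 1 ≤ d := by
  cases h <;> omega

instance (n : ℕ) : IsProbabilityMeasure (stdGaussianVec n) := by
  unfold stdGaussianVec
  infer_instance

theorem integrable_exp_evInner {n : ℕ} (l : ℝ) (v : Fin n → ℝ) :
    Integrable (fun g => Real.exp (l * evInner g v)) (stdGaussianVec n) := by
  have h := Integrable.fintype_prod (μ := fun _ : Fin n => gaussianReal 0 1)
    (f := fun i (x : ℝ) => Real.exp (l * v i * x)) fun i => integrable_exp_mul_gaussianReal _
  refine h.congr (Filter.Eventually.of_forall fun g => ?_)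
  simp only [← Real.exp_sum, evInner, Finset.mul_sum]
  congr 1
  exact Finset.sum_congr rfl fun i _ => by ring

/-- The moment generating function of a linear functional of a standard Gaussian vector. -/
theorem integral_exp_evInner {n : ℕ} (l : ℝ) (v : Fin n → ℝ) :
    ∫ g, Real.exp (l * evInner g v) ∂stdGaussianVec n = Real.exp (l ^ 2 * evNorm v ^ 2 / 2) := by
  have h1 : ∀ g : Fin n → ℝ, Real.exp (l * evInner g v) = ∏ i, Real.exp (l * v i * g i) := by
    intro g
    rw [← Real.exp_sum, evInner, Finset.mul_sum]
    congr 1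
    exact Finset.sum_congr rfl fun i _ => by ring
  have h2 : ∀ t : ℝ, ∫ x, Real.exp (t * x) ∂gaussianReal 0 1 = Real.exp (t ^ 2 / 2) := by
    intro t
    have := congrFun (mgf_id_gaussianReal (μ := 0) (v := 1)) t
    simpa [mgf] using this
  simp_rw [h1]
  rw [stdGaussianVec, integral_fintype_prod_eq_prod (μ := fun _ : Fin n => gaussianReal 0 1)
    (fun i (x : ℝ) => Real.exp (l * v i * x))]
  simp_rw [h2]
  rw [← Real.exp_sum, evNorm_sq, Finset.mul_sum, Finset.sum_div]
  congr 1
  exact Finset.sum_congr rfl fun i _ => by ring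

theorem integrable_sq_evNorm (n : ℕ) :
    Integrable (fun g => evNorm g ^ 2) (stdGaussianVec n) := by
  simp_rw [evNorm_sq]
  refine integrable_finsetSum _ fun i _ => ?_
  exact integrable_comp_eval (μ := fun _ : Fin n => gaussianReal 0 1) (f := fun x : ℝ => x ^ 2)
    ((memLp_id_gaussianReal 2).integrable_sq)

theorem integral_sq_evNorm (n : ℕ) : ∫ g, evNorm g ^ 2 ∂stdGaussianVec n = n := by
  have hint : Integrable (fun x : ℝ => x ^ 2) (gaussianReal 0 1) :=
    (memLp_id_gaussianReal 2).integrable_sq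
  have hvar : ∫ x, x ^ 2 ∂gaussianReal 0 1 = 1 := by
    have := variance_id_gaussianReal (μ := 0) (v := 1)
    rw [variance_of_integral_eq_zero (by fun_prop) (by simp)] at this
    simpa using this
  have hcoord : ∀ i : Fin n, ∫ g, g i ^ 2 ∂stdGaussianVec n = 1 := fun i =>
    (integral_comp_eval (μ := fun _ : Fin n => gaussianReal 0 1) (i := i)
      (f := fun x : ℝ => x ^ 2) hint.aestronglyMeasurable).trans hvar
  simp_rw [evNorm_sq]
  rw [integral_finsetSum _ fun i _ => ?_]
  · simp [hcoord]
  · exact integrable_comp_eval (μ := fun _ : Fin n => gaussianReal 0 1) (f := fun x : ℝ => x ^ 2)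
      hint

/-- A finite family of linear functionals of a standard Gaussian vector is dominated by a single
integrable function whose integral obeys the maximal inequality. -/
theorem exists_integrable_majorant {n : ℕ} (P : Finset (Fin n → ℝ)) {a l τ : ℝ} (hl : 0 < l)
    (hτ : 0 ≤ τ) (hP : ∀ v ∈ P, evNorm v ≤ a)
    (hcard : 2 * (P.card : ℝ) ≤ Real.exp (τ - l ^ 2 * a ^ 2 / 2)) :
    ∃ F : (Fin n → ℝ) → ℝ, Integrable F (stdGaussianVec n) ∧
      ∫ g, F g ∂stdGaussianVec n ≤ (τ + 1) / l ∧ (∀ g, 0 ≤ F g) ∧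
      ∀ g, ∀ v ∈ P, |evInner g v| ≤ F g := by
  let f : (Fin n → ℝ) → (Fin n → ℝ) → ℝ := fun v g =>
    Real.exp (l * evInner g v) + Real.exp (-l * evInner g v)
  have hf : ∀ v, Integrable (f v) (stdGaussianVec n) := fun v =>
    (integrable_exp_evInner l v).add (integrable_exp_evInner (-l) v)
  have hfint : ∀ v ∈ P, ∫ g, f v g ∂stdGaussianVec n ≤ 2 * Real.exp (l ^ 2 * a ^ 2 / 2) := by
    intro v hv
    have h1 : ∫ g, f v g ∂stdGaussianVec n = 2 * Real.exp (l ^ 2 * evNorm v ^ 2 / 2) := by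
      simp only [f]
      rw [integral_add (integrable_exp_evInner l v) (integrable_exp_evInner (-l) v),
        integral_exp_evInner, integral_exp_evInner, neg_sq, two_mul]
    rw [h1]
    have := evNorm_nonneg v
    have := hP v hv
    gcongr
  have hsum : Integrable (fun g => ∑ v ∈ P, f v g) (stdGaussianVec n) :=
    integrable_finsetSum _ fun v _ => hf v
  refine ⟨fun g => τ / l + Real.exp (-τ) / l * ∑ v ∈ P, f v g,
    (integrable_const _).add (hsum.const_mul _), ?_, fun g => ?_, fun g v hv => ?_⟩
  · rw [integral_add (integrable_const _) (hsum.const_mul _), integral_const_mul,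
      integral_finsetSum _ fun v _ => hf v, integral_const, probReal_univ, one_smul, add_div]
    gcongr
    rw [div_mul_eq_mul_div]
    gcongr
    calc Real.exp (-τ) * ∑ v ∈ P, ∫ g, f v g ∂stdGaussianVec n
        ≤ Real.exp (-τ) * ∑ _v ∈ P, 2 * Real.exp (l ^ 2 * a ^ 2 / 2) := by
          gcongr with v hv
          exact hfint v hv
      _ = Real.exp (-τ) * (2 * (P.card : ℝ) * Real.exp (l ^ 2 * a ^ 2 / 2)) := by
          rw [Finset.sum_const, nsmul_eq_mul]; ring
      _ ≤ Real.exp (-τ) * (Real.exp (τ - l ^ 2 * a ^ 2 / 2) * Real.exp (l ^ 2 * a ^ 2 / 2)) := by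
          gcongr
      _ = 1 := by
          rw [← Real.exp_add, ← Real.exp_add, ← Real.exp_zero]
          congr 1
          ring
  · have : 0 ≤ ∑ v ∈ P, f v g := Finset.sum_nonneg fun v _ => by positivity
    positivity
  · have h1 : Real.exp (l * |evInner g v|) ≤ f v g := by
      rcases abs_cases (evInner g v) with ⟨h, -⟩ | ⟨h, -⟩
      · rw [h]
        exact le_add_of_nonneg_right (Real.exp_nonneg _)
      · rw [h, mul_neg, ← neg_mul]
        exact le_add_of_nonneg_left (Real.exp_nonneg _)
    have h2 : f v g ≤ ∑ v ∈ P, f v g :=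
      Finset.single_le_sum (f := fun v => f v g) (fun v _ => by positivity) hv
    have h3 : l * |evInner g v| ≤ τ + Real.exp (-τ) * ∑ v ∈ P, f v g := by
      have h4 := Real.add_one_le_exp (-τ + l * |evInner g v|)
      rw [Real.exp_add] at h4
      have h5 := mul_le_mul_of_nonneg_left (h1.trans h2) (Real.exp_nonneg (-τ))
      linarith
    beta_reduce
    rw [div_mul_eq_mul_div, ← add_div, le_div_iff₀ hl]
    linarith

theorem meanWidth_le_of_majorant {n : ℕ} {S : Set (Fin n → ℝ)} {F : (Fin n → ℝ) → ℝ}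
    (hF : Integrable F (stdGaussianVec n)) (hF0 : ∀ g, 0 ≤ F g)
    (hS : ∀ g, ∀ x ∈ S, |evInner g x| ≤ F g) :
    meanWidth S ≤ 2 * ∫ g, F g ∂stdGaussianVec n := by
  rw [meanWidth, ← integral_const_mul]
  have hub : ∀ g, ∀ t ∈ {t : ℝ | ∃ x ∈ S, ∃ x' ∈ S, t = evInner g (x - x')}, t ≤ 2 * F g := by
    rintro g _ ⟨x, hx, x', hx', rfl⟩
    rw [evInner_sub]
    linarith [(abs_le.1 (hS g x hx)).2, (abs_le.1 (hS g x' hx')).1]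
  refine integral_mono_of_nonneg (Filter.Eventually.of_forall fun g => ?_) (hF.const_mul 2)
    (Filter.Eventually.of_forall fun g => ?_)
  · rcases S.eq_empty_or_nonempty with rfl | ⟨x, hx⟩
    · simp
    · refine le_csSup ⟨_, hub g⟩ ⟨x, hx, x, hx, ?_⟩
      simp [evInner]
  · exact Real.sSup_le (hub g) (mul_nonneg zero_le_two (hF0 g))

/-- Chaining along a sequence of finite nets of geometrically decreasing scale. -/
theorem meanWidth_le_of_nets {n : ℕ} {S : Set (Fin n → ℝ)} {T : ℕ → Finset (Fin n → ℝ)}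
    {l τ : ℕ → ℝ} (hT0 : T 0 = {0})
    (hT : ∀ k, ∀ x ∈ S, ∃ c ∈ T k, evNorm (x - c) ≤ 1 / 2 ^ k) (hl : ∀ k, 0 < l k)
    (hτ : ∀ k, 0 ≤ τ k)
    (hcard : ∀ k, 2 * (((T k).card : ℝ) * (T (k + 1)).card) ≤
      Real.exp (τ k - l k ^ 2 * (2 / 2 ^ k) ^ 2 / 2)) :
    meanWidth S ≤ 2 * (∑ k ∈ Finset.range n, (τ k + 1) / l k + 1) := by
  classical
  let P : ℕ → Finset (Fin n → ℝ) := fun k =>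
    ((T (k + 1) ×ˢ T k).image fun p => p.1 - p.2).filter fun v => evNorm v ≤ 2 / 2 ^ k
  have hPcard : ∀ k, 2 * ((P k).card : ℝ) ≤
      Real.exp (τ k - l k ^ 2 * (2 / 2 ^ k) ^ 2 / 2) := by
    intro k
    refine le_trans (mul_le_mul_of_nonneg_left ?_ zero_le_two) (hcard k)
    have h : (P k).card ≤ (T k).card * (T (k + 1)).card := by
      refine (Finset.card_filter_le _ _).trans (Finset.card_image_le.trans ?_)
      rw [Finset.card_product, mul_comm]
    exact_mod_cast h
  choose F hFint hFle hF0 hFP using fun k =>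
    exists_integrable_majorant (P k) (hl k) (hτ k) (fun v hv => (Finset.mem_filter.1 hv).2)
      (hPcard k)
  let H : (Fin n → ℝ) → ℝ := fun g =>
    ∑ k ∈ Finset.range n, F k g + 1 / 2 ^ n * (1 + evNorm g ^ 2)
  have hFsum : Integrable (fun g => ∑ k ∈ Finset.range n, F k g) (stdGaussianVec n) :=
    integrable_finsetSum _ fun k _ => hFint k
  have hrem : Integrable (fun g => 1 / 2 ^ n * (1 + evNorm g ^ 2)) (stdGaussianVec n) :=
    ((integrable_const _).add (integrable_sq_evNorm n)).const_mul _
  have hH : Integrable H (stdGaussianVec n) := hFsum.add hrem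
  have hHint : ∫ g, H g ∂stdGaussianVec n ≤ ∑ k ∈ Finset.range n, (τ k + 1) / l k + 1 := by
    simp only [H]
    rw [integral_add hFsum hrem, integral_const_mul,
      integral_add (integrable_const _) (integrable_sq_evNorm n), integral_sq_evNorm,
      integral_finsetSum _ fun k _ => hFint k, integral_const, probReal_univ, one_smul]
    refine add_le_add (Finset.sum_le_sum fun k _ => hFle k) ?_
    rw [one_div, inv_mul_le_iff₀ (by positivity), mul_one]
    have : n + 1 ≤ 2 ^ n := Nat.lt_two_pow_self
    have : (n : ℝ) + 1 ≤ 2 ^ n := by exact_mod_cast this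
    linarith
  refine (meanWidth_le_of_majorant hH (fun g => ?_) fun g x hx => ?_).trans
    (mul_le_mul_of_nonneg_left hHint zero_le_two)
  · have := Finset.sum_nonneg fun k (_ : k ∈ Finset.range n) => hF0 k g
    positivity
  choose c hcT hxc using fun k => hT k x hx
  have hc0 : c 0 = 0 := by simpa [hT0] using hcT 0
  have hchain : ∀ m, |evInner g (c m)| ≤ ∑ k ∈ Finset.range m, F k g := by
    intro m
    induction m with
    | zero => simp [hc0, evInner]
    | succ m ih =>
      have hmem : c (m + 1) - c m ∈ P m := by
        refine Finset.mem_filter.2 ⟨Finset.mem_image.2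
          ⟨(c (m + 1), c m), Finset.mem_product.2 ⟨hcT _, hcT _⟩, rfl⟩, ?_⟩
        have h1 : c (m + 1) - c m = -(x - c (m + 1)) + (x - c m) := by abel
        have h2 : (1 : ℝ) / 2 ^ (m + 1) ≤ 1 / 2 ^ m :=
          one_div_le_one_div_of_le (by positivity) (pow_le_pow_right₀ one_le_two (by omega))
        calc evNorm (c (m + 1) - c m) ≤ 1 / 2 ^ (m + 1) + 1 / 2 ^ m := by
              rw [h1]
              refine (evNorm_add_le _ _).trans ?_
              rw [evNorm_neg]
              exact add_le_add (hxc _) (hxc _)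
          _ ≤ 1 / 2 ^ m + 1 / 2 ^ m := by gcongr
          _ = 2 / 2 ^ m := by ring
      have h3 : evInner g (c (m + 1)) = evInner g (c m) + evInner g (c (m + 1) - c m) := by
        rw [evInner_sub]; ring
      rw [h3, Finset.sum_range_succ]
      exact (abs_add_le _ _).trans (add_le_add ih (hFP m g _ hmem))
  have hsplit : evInner g x = evInner g (c n) + evInner g (x - c n) := by
    rw [evInner_sub]; ring
  rw [hsplit]
  refine (abs_add_le _ _).trans (add_le_add (hchain n) ((abs_evInner_le _ _).trans ?_))
  rw [mul_comm]
  have := evNorm_nonneg g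
  have := evNorm_nonneg (x - c n)
  exact mul_le_mul (hxc n) (by nlinarith) (by positivity) (by positivity)

theorem sum_two_div_two_pow_mul_le (n : ℕ) {A B : ℝ} (hA : 0 ≤ A) (hB : 0 ≤ B) :
    ∑ k ∈ Finset.range n, 2 / 2 ^ k * (A + B * (k / 2 + 6)) ≤ 4 * A + 26 * B := by
  have h : ∑ k ∈ Finset.range n, 2 / 2 ^ k * (A + B * (k / 2 + 6)) =
      4 * A + 26 * B - (4 * A + (2 * n + 26) * B) / 2 ^ n := by
    induction n with
    | zero => simp
    | succ n ih =>
      rw [Finset.sum_range_succ, ih, pow_succ]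
      push_cast
      field_simp
      ring
  rw [h]
  exact sub_le_self _ (by positivity)

/-- Mean width of the part in the unit ball of a Lipschitz image of a ball. -/
theorem meanWidth_lipschitz_image_le {s n : ℕ} {r M : ℝ} (hr : 1 ≤ r) (hM : 2 ≤ M)
    {G : (Fin s → ℝ) → (Fin n → ℝ)} (hG : ∀ v v', evNorm (G v - G v') ≤ M * evNorm (v - v')) :
    meanWidth {x : Fin n → ℝ | ∃ z : Fin s → ℝ, evNorm z ≤ r ∧ evNorm (G z) ≤ 1 ∧ x = G z} ≤
      8 * r * Real.sqrt s + 56 * Real.sqrt (s * Real.log M) := by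
  rcases Nat.eq_zero_or_pos s with rfl | hs
  · have h0 : ∀ z : Fin 0 → ℝ, G z = G 0 := fun z => congrArg G (Subsingleton.elim _ _)
    refine le_trans (b := 0) (integral_nonpos fun g => Real.sSup_nonpos ?_) (by simp)
    rintro _ ⟨_, ⟨z, -, -, rfl⟩, _, ⟨z', -, -, rfl⟩, rfl⟩
    simp [h0 z, h0 z', evInner]
  have hs1 : (1 : ℝ) ≤ s := by exact_mod_cast hs
  have hlogM : 1 / 2 ≤ Real.log M := by
    have := Real.log_two_gt_d9
    have := Real.log_le_log two_pos hM
    linarith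
  have hlogr : 0 ≤ Real.log r := Real.log_nonneg hr
  have hlogr' : Real.log r ≤ r := (Real.log_le_sub_one_of_pos (by linarith)).trans (by linarith)
  set R := Real.sqrt (s * Real.log M) with hR
  have hRsq : R ^ 2 = s * Real.log M := Real.sq_sqrt (by positivity)
  have hssq : Real.sqrt s ^ 2 = s := Real.sq_sqrt (by positivity)
  have hs0 : 1 ≤ Real.sqrt s := Real.one_le_sqrt.2 hs1
  have hR0 : 0 ≤ R := Real.sqrt_nonneg _
  have hsR : Real.sqrt s ≤ 2 * R := by
    rw [← abs_of_nonneg hR0]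
    refine Real.sqrt_le_iff.2 ⟨by positivity, ?_⟩
    rw [mul_pow, sq_abs, hRsq]
    nlinarith
  have hRpos : 0 < R := by linarith
  have hnets : ∀ k : ℕ, ∃ t : Finset (Fin n → ℝ), (k = 0 → t = {0}) ∧
      (t.card : ℝ) ≤ (r * M ^ (k + 3)) ^ s ∧
      ∀ x ∈ {x | ∃ z : Fin s → ℝ, evNorm z ≤ r ∧ evNorm (G z) ≤ 1 ∧ x = G z},
        ∃ c ∈ t, evNorm (x - c) ≤ 1 / 2 ^ k := by
    intro k
    have hMk : 1 ≤ M ^ (k + 3) := one_le_pow₀ (by linarith)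
    rcases Nat.eq_zero_or_pos k with rfl | hk
    · refine ⟨{0}, fun _ => rfl, ?_, ?_⟩
      · simpa using one_le_pow₀ (one_le_mul_of_one_le_of_one_le hr hMk)
      · rintro _ ⟨z, -, hz, rfl⟩
        exact ⟨0, by simp, by simpa using hz⟩
    · obtain ⟨t, htc, ht⟩ := exists_finset_net_image (r := r) (ε := 1 / 2 ^ k) (by linarith)
        (by linarith) (by positivity) hG
      refine ⟨t, by omega, htc.trans (pow_le_pow_left₀ (by positivity) ?_ s), ?_⟩
      · have h1 : (2 : ℝ) ^ k ≤ M ^ k := pow_le_pow_left₀ zero_le_two hM k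
        have h2 : (1 : ℝ) ≤ 2 ^ k := one_le_pow₀ one_le_two
        have h3 : (4 : ℝ) ≤ M ^ 2 := by nlinarith
        have h5 : 1 ≤ r * M * 2 ^ k := by
          have : 1 ≤ r * M := by nlinarith
          nlinarith
        calc 2 * r * M / (1 / 2 ^ k) + 1 = 2 * (r * M * 2 ^ k) + 1 := by field_simp
          _ ≤ r * M * 2 ^ k * 4 := by linarith
          _ ≤ r * M * M ^ k * M ^ 2 := by gcongr
          _ = r * M ^ (k + 3) := by ring
      · rintro _ ⟨z, hz, -, rfl⟩
        exact ht z hz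
  choose T hT0 hTcard hTnet using hnets
  refine (meanWidth_le_of_nets (l := fun k => 3 * R * 2 ^ k)
    (τ := fun k => 3 * s * Real.log r + 3 * R ^ 2 * (k + 4) + 18 * R ^ 2) (hT0 0 rfl) hTnet
    (fun k => by positivity) (fun k => by positivity) fun k => ?_).trans ?_
  · have hB : 2 ≤ r * M ^ (k + 4) := by
      have h1 : M ≤ M ^ (k + 4) := le_self_pow₀ (by linarith) (by omega)
      nlinarith
    have hexp : 3 * s * Real.log r + 3 * R ^ 2 * (k + 4) + 18 * R ^ 2 -
        (3 * R * 2 ^ k) ^ 2 * (2 / 2 ^ k) ^ 2 / 2 =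
        ((3 * s : ℕ) : ℝ) * Real.log (r * M ^ (k + 4)) := by
      rw [Real.log_mul (by positivity) (by positivity), Real.log_pow, hRsq]
      have : (3 * R * 2 ^ k) ^ 2 * (2 / 2 ^ k) ^ 2 = 36 * (s * Real.log M) := by
        rw [← hRsq]
        field_simp
        ring
      rw [this]
      push_cast
      ring
    rw [hexp, ← Real.log_pow, Real.exp_log (by positivity)]
    have hmono : r * M ^ (k + 3) ≤ r * M ^ (k + 4) := by
      gcongr
      · linarith
      · omega
    calc 2 * (((T k).card : ℝ) * (T (k + 1)).card)
        ≤ (r * M ^ (k + 4)) ^ s * ((r * M ^ (k + 4)) ^ s * (r * M ^ (k + 4)) ^ s) := by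
          gcongr
          · exact hB.trans (le_self_pow₀ (by linarith) (by omega))
          · exact (hTcard k).trans (pow_le_pow_left₀ (by positivity) hmono s)
          · exact hTcard (k + 1)
      _ = (r * M ^ (k + 4)) ^ (3 * s) := by ring
  · have hterm : ∀ k : ℕ,
        (3 * s * Real.log r + 3 * R ^ 2 * (k + 4) + 18 * R ^ 2 + 1) / (3 * R * 2 ^ k) ≤
          2 / 2 ^ k * (r * Real.sqrt s + R * (k / 2 + 6)) := by
      intro k
      rw [div_le_iff₀ (by positivity)]
      have h1 : 2 / 2 ^ k * (r * Real.sqrt s + R * (k / 2 + 6)) * (3 * R * 2 ^ k) =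
          6 * R * (r * Real.sqrt s) + 3 * R ^ 2 * k + 36 * R ^ 2 := by
        field_simp
        ring
      have h2 : s * Real.log r ≤ 2 * R * (r * Real.sqrt s) := by
        calc s * Real.log r ≤ s * r := by gcongr
          _ = Real.sqrt s * (Real.sqrt s * r) := by rw [← mul_assoc, ← sq, hssq]
          _ ≤ 2 * R * (Real.sqrt s * r) := by gcongr
          _ = _ := by ring
      rw [h1]
      nlinarith
    have hsum := (Finset.sum_le_sum fun k (_ : k ∈ Finset.range n) => hterm k).trans
      (sum_two_div_two_pow_mul_le n (A := r * Real.sqrt s) (by positivity) hR0)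
    linarith

/-- bound on the Gaussian mean width of the (norm-constrained) range of a
generative network. -/
theorem meanWidth_mlp_range_le :
    ∃ C' > (0 : ℝ),
      ∀ (s n d N : ℕ) (L wmax r : ℝ) (G : (Fin s → ℝ) → (Fin n → ℝ)),
        IsMLP L wmax N d s n G →
        2 ≤ L * (N : ℝ) * wmax → 1 ≤ r →
        meanWidth {x : Fin n → ℝ | ∃ z : Fin s → ℝ, evNorm z ≤ r ∧ evNorm (G z) ≤ 1 ∧ x = G z} ≤
          8 * r * Real.sqrt (s : ℝ) +
            C' * Real.sqrt ((s : ℝ) * (d : ℝ) * Real.log (L * (N : ℝ) * wmax)) := by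
  refine ⟨56, by norm_num, fun s n d N L wmax r G hG hK hr => ?_⟩
  have hM : 2 ≤ (L * N * wmax) ^ d :=
    hK.trans (le_self_pow₀ (by linarith) (by have := hG.depth_pos; omega))
  have h := meanWidth_lipschitz_image_le hr hM (hG.evNorm_sub_le hK)
  rwa [Real.log_pow, ← mul_assoc] at h
end
end
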